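/- arXiv:2512.09528 — 2 statements merged into one kernel-verified Lean document; each statement's English description precedes it below -/
import Mathlib

section
/- Let f : T → T be a homeomorphism of a compact metric space and ν an ergodic f-invariant Borel probability measure with h_ν(f) < ∞. Define two-sided Bowen balls B_n^{f,±}(t,ε) = {s : max_{−n≤i≤n} d(fⁱ(t), fⁱ(s)) < ε}. Then for ν-almost every t, sup_{ε>0} liminf_{n→∞} −(1/n) log ν(B_n^{f,±}(t,ε)) = sup_{ε>0} limsup_{n→∞} −(1/n) log ν(B_n^{f,±}(t,ε)) = 2·h_ν(f). -/
open Filter MeasureTheory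
open scoped ENNReal

variable {T : Type*} [MetricSpace T] [CompactSpace T] [MeasurableSpace T] [BorelSpace T]

/-- A finite measurable partition of `T`, encoded by the map sending a point to the
element of the partition containing it. -/
structure FinMeasPartition (T : Type*) [MeasurableSpace T] where
  part : T → Set T
  mem_part : ∀ x, x ∈ part x
  measSet : ∀ x, MeasurableSet (part x)
  part_eq : ∀ x y, y ∈ part x → part y = part x
  finite_range : (Set.range part).Finite

/-- One-sided cell: the element of `⋁_{i=0}^{n-1} f^{-i} ξ` containing `x`. -/
def oneSidedCell (f : Equiv.Perm T) (P : FinMeasPartition T) (n : ℕ) (x : T) : Set T :=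
  {y : T | ∀ i : ℕ, i < n → (f ^ i) y ∈ P.part ((f ^ i) x)}

/-- Two-sided cell: the element of `⋁_{i=-n}^{n} f^{-i} ξ` containing `x`. -/
def twoSidedCell (f : Equiv.Perm T) (P : FinMeasPartition T) (n : ℕ) (x : T) : Set T :=
  {y : T | ∀ i : ℤ, |i| ≤ (n : ℤ) → (f ^ i) y ∈ P.part ((f ^ i) x)}

/-- Entropy of `f` with respect to the partition `P` and measure `ν`, defined via
`(1/n) H_ν(⋁_{i=0}^{n-1} f^{-i} ξ)` with `H_ν(η) = ∫ -log ν(cell_η(x)) dν(x)`. -/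
noncomputable def partitionEntropy (f : Equiv.Perm T) (ν : Measure T)
    (P : FinMeasPartition T) : ℝ :=
  Filter.liminf (fun n : ℕ =>
    (∫ x, -Real.log (ν (oneSidedCell f P n x)).toReal ∂ν) / n) Filter.atTop

/-- Kolmogorov–Sinai entropy `h_ν(f)`, as a supremum over finite measurable partitions. -/
noncomputable def ksEntropy (f : Equiv.Perm T) (ν : Measure T) : ℝ≥0∞ :=
  ⨆ P : FinMeasPartition T, ENNReal.ofReal (partitionEntropy f ν P)

/-- One-sided Bowen ball `B_n^f(t,ε)`. -/
def oneSidedBall (f : Equiv.Perm T) (n : ℕ) (t : T) (ε : ℝ) : Set T :=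
  {s : T | ∀ i : ℕ, i ≤ n → dist ((f ^ i) t) ((f ^ i) s) < ε}

/-- Two-sided Bowen ball `B_n^{f,±}(t,ε)`. -/
def twoSidedBall (f : Equiv.Perm T) (n : ℕ) (t : T) (ε : ℝ) : Set T :=
  {s : T | ∀ i : ℤ, |i| ≤ (n : ℤ) → dist ((f ^ i) t) ((f ^ i) s) < ε}

namespace BK
set_option linter.unusedSectionVars false

section Birkhoff
variable {Ω : Type*} [MeasurableSpace Ω]

/-- Running maximum of Birkhoff sums. -/
noncomputable def runMax (f : Ω → Ω) (φ : Ω → ℝ) : ℕ → Ω → ℝ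
  | 0, _ => 0
  | n + 1, x => max 0 (φ x + runMax f φ n (f x))

lemma runMax_nonneg (f : Ω → Ω) (φ : Ω → ℝ) (n : ℕ) (x : Ω) : 0 ≤ runMax f φ n x := by
  cases n with
  | zero => simp [runMax]
  | succ n => simp [runMax]

lemma runMax_le_succ (f : Ω → Ω) (φ : Ω → ℝ) (n : ℕ) (x : Ω) :
    runMax f φ n x ≤ runMax f φ (n + 1) x := by
  induction n generalizing x with
  | zero => exact runMax_nonneg f φ 1 x
  | succ n ih =>
    have := ih (f x)
    change max 0 (φ x + runMax f φ n (f x)) ≤ max 0 (φ x + runMax f φ (n + 1) (f x))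
    gcongr

lemma runMax_mono (f : Ω → Ω) (φ : Ω → ℝ) (x : Ω) : Monotone (fun n => runMax f φ n x) :=
  monotone_nat_of_le_succ (fun n => runMax_le_succ f φ n x)

lemma birkhoffSum_le_runMax (f : Ω → Ω) (φ : Ω → ℝ) (n : ℕ) (x : Ω) :
    birkhoffSum f φ n x ≤ runMax f φ n x := by
  induction n generalizing x with
  | zero => simp [runMax]
  | succ n ih =>
    rw [birkhoffSum_succ']
    exact le_max_of_le_right (by linarith [ih (f x)])

lemma runMax_measurable {f : Ω → Ω} {φ : Ω → ℝ} (hf : Measurable f) (hφ : Measurable φ) (n : ℕ) :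
    Measurable (runMax f φ n) := by
  induction n with
  | zero => exact measurable_const
  | succ n ih => exact measurable_const.max (hφ.add (ih.comp hf))

lemma runMax_integrable {f : Ω → Ω} {φ : Ω → ℝ} {μ : Measure Ω} [IsFiniteMeasure μ]
    (hf : MeasurePreserving f μ μ) (hφ : Integrable φ μ) (n : ℕ) :
    Integrable (runMax f φ n) μ := by
  induction n with
  | zero => exact integrable_zero _ _ _
  | succ n ih =>
    have h1 : Integrable (fun x => runMax f φ n (f x)) μ := hf.integrable_comp_of_integrable ih
    have h2 : Integrable (fun x => φ x + runMax f φ n (f x)) μ := hφ.add h1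
    exact (integrable_const (0:ℝ)).sup h2

lemma birkhoff_neg {f : Ω → Ω} {φ : Ω → ℝ} {μ : Measure Ω} [IsProbabilityMeasure μ]
    (hf : Ergodic f μ) (hm : Measurable φ) (hφ : Integrable φ μ) (hneg : ∫ x, φ x ∂μ < 0) :
    ∀ᵐ x ∂μ, ∃ B : ℝ, ∀ n, birkhoffSum f φ n x ≤ B := by
  set E : Set Ω := {x | ∀ B : ℕ, ∃ n, (B : ℝ) < runMax f φ n x} with hE
  have hEm : MeasurableSet E := by
    have : E = ⋂ B : ℕ, ⋃ n : ℕ, {x | (B : ℝ) < runMax f φ n x} := by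
      ext x; simp [hE]
    rw [this]
    exact MeasurableSet.iInter fun B => MeasurableSet.iUnion fun n =>
      measurableSet_lt measurable_const (runMax_measurable hf.measurable hm n)
  have hEinv : f ⁻¹' E = E := by
    ext x
    simp only [hE, Set.mem_preimage, Set.mem_ofPred_eq]
    constructor
    · intro h B
      obtain ⟨K, hK⟩ := exists_nat_ge (B + |φ x|)
      obtain ⟨n, hn⟩ := h K
      refine ⟨n + 1, lt_max_of_lt_right ?_⟩
      linarith [neg_abs_le (φ x)]
    · intro h B
      obtain ⟨K, hK⟩ := exists_nat_ge (B + |φ x|)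
      obtain ⟨n, hn⟩ := h K
      cases n with
      | zero =>
        simp only [runMax] at hn
        have : (0:ℝ) ≤ K := Nat.cast_nonneg K
        linarith
      | succ n =>
        refine ⟨n, ?_⟩
        simp only [runMax] at hn
        rcases lt_max_iff.1 hn with h | h
        · have : (0:ℝ) ≤ K := Nat.cast_nonneg K
          linarith
        · linarith [le_abs_self (φ x)]
  rcases hf.toPreErgodic.ae_mem_or_ae_notMem hEm hEinv with h | h
  · exfalso
    have hlim : Tendsto (fun n : ℕ => ∫ x, max (-runMax f φ n (f x)) (φ x) ∂μ) atTop
        (nhds (∫ x, φ x ∂μ)) := by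
      refine tendsto_integral_of_dominated_convergence (fun x => |φ x|) ?_ hφ.abs ?_ ?_
      · intro n
        exact (((runMax_measurable hf.measurable hm n).comp hf.measurable).neg.max
          hm).aestronglyMeasurable
      · intro n
        refine Eventually.of_forall fun x => ?_
        have := runMax_nonneg f φ n (f x)
        rw [Real.norm_eq_abs, abs_le]
        exact ⟨le_max_of_le_right (neg_abs_le _), max_le (by linarith [abs_nonneg (φ x)])
          (le_abs_self _)⟩
      · filter_upwards [h] with x hx
        have hx' : f x ∈ E := by rw [← hEinv] at hx; exact hx
        obtain ⟨K, hK⟩ := exists_nat_ge (|φ x|)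
        obtain ⟨n, hn⟩ := hx' K
        refine tendsto_const_nhds.congr' ?_
        filter_upwards [eventually_ge_atTop n] with m hm'
        have := runMax_mono f φ (f x) hm'
        simp only at this
        rw [max_eq_right]
        linarith [neg_abs_le (φ x)]
    have hnn : ∀ n : ℕ, 0 ≤ ∫ x, max (-runMax f φ n (f x)) (φ x) ∂μ := by
      intro n
      have e : ∀ x, max (-runMax f φ n (f x)) (φ x)
          = runMax f φ (n+1) x - runMax f φ n (f x) := by
        intro x
        simp only [runMax]
        rcases le_total 0 (φ x + runMax f φ n (f x)) with h | h
        · rw [max_eq_right h, max_eq_right (by linarith)]; ring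
        · rw [max_eq_left h, max_eq_left (by linarith)]; ring
      simp_rw [e]
      have hmp := hf.toMeasurePreserving
      have hi : Integrable (fun x => runMax f φ n (f x)) μ :=
        hmp.integrable_comp_of_integrable (runMax_integrable hmp hφ n)
      rw [integral_sub (runMax_integrable hmp hφ _) hi]
      have e2 : ∫ x, runMax f φ n (f x) ∂μ = ∫ x, runMax f φ n x ∂μ := by
        conv_rhs => rw [← hmp.map_eq]
        rw [integral_map hmp.aemeasurable
          (runMax_measurable hf.measurable hm n).aestronglyMeasurable]
      rw [e2, sub_nonneg]
      exact integral_mono (runMax_integrable hmp hφ _) (runMax_integrable hmp hφ _)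
        (fun x => runMax_le_succ f φ n x)
    have := ge_of_tendsto' hlim hnn
    linarith
  · filter_upwards [h] with x hx
    simp only [hE, Set.mem_ofPred_eq, not_forall, not_exists, not_lt] at hx
    obtain ⟨B, hB⟩ := hx
    exact ⟨B, fun n => (birkhoffSum_le_runMax f φ n x).trans (hB n)⟩

lemma birkhoff_le {f : Ω → Ω} {φ : Ω → ℝ} {μ : Measure Ω} [IsProbabilityMeasure μ]
    (hf : Ergodic f μ) (hm : Measurable φ) (hφ : Integrable φ μ) {c : ℝ}
    (hc : ∫ x, φ x ∂μ < c) :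
    ∀ᵐ x ∂μ, ∃ B : ℝ, ∀ n : ℕ, birkhoffSum f φ n x ≤ n * c + B := by
  have := birkhoff_neg (φ := fun x => φ x - c) hf (hm.sub_const c) (hφ.sub (integrable_const c))
    (by rw [integral_sub hφ (integrable_const c)]; simp; exact hc)
  filter_upwards [this] with x ⟨B, hB⟩
  refine ⟨B, fun n => ?_⟩
  have := hB n
  simp only [birkhoffSum, Finset.sum_sub_distrib, Finset.sum_const, Finset.card_range,
    nsmul_eq_mul] at this ⊢
  linarith

lemma birkhoffSum_shift {f g : Ω → Ω} (hfg : ∀ x, f (g x) = x) (φ : Ω → ℝ) (m n : ℕ) (x : Ω) :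
    birkhoffSum f φ (m + n) (g^[m] x) = birkhoffSum g (φ ∘ g) m x + birkhoffSum f φ n x := by
  have hinv : Function.LeftInverse f g := hfg
  rw [birkhoffSum_add, hinv.iterate m x]
  congr 1
  induction m generalizing x with
  | zero => simp
  | succ m ih =>
    rw [birkhoffSum_succ, birkhoffSum_succ']
    have h2 := ih (g x)
    rw [Function.iterate_succ_apply, h2, ← Function.iterate_succ_apply,
      Function.iterate_succ_apply', ← Function.iterate_succ_apply' g m x,
      Function.iterate_succ_apply g m x, hinv.iterate m]
    simp only [Function.comp]
    ring

/-- Two-sided Birkhoff upper bound. -/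
lemma birkhoff_two_le {f g : Ω → Ω} {φ : Ω → ℝ} {μ : Measure Ω} [IsProbabilityMeasure μ]
    (hf : Ergodic f μ) (hg : Ergodic g μ) (hfg : ∀ x, f (g x) = x)
    (hm : Measurable φ) (hφ : Integrable φ μ) {c : ℝ}
    (hc : ∫ x, φ x ∂μ < c) :
    ∀ᵐ x ∂μ, ∃ B : ℝ, ∀ m n : ℕ, birkhoffSum f φ (m + n) (g^[m] x) ≤ (m + n : ℕ) * c + B := by
  have h2 : ∫ x, (φ ∘ g) x ∂μ < c := by
    have : ∫ x, (φ ∘ g) x ∂μ = ∫ x, φ x ∂μ := by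
      conv_rhs => rw [← hg.toMeasurePreserving.map_eq]
      rw [integral_map hg.toMeasurePreserving.aemeasurable hm.aestronglyMeasurable]
      rfl
    rw [this]; exact hc
  filter_upwards [birkhoff_le hf hm hφ hc, birkhoff_le hg (hm.comp hg.measurable)
    (hg.toMeasurePreserving.integrable_comp_of_integrable hφ) h2] with x ⟨B, hB⟩ ⟨B', hB'⟩
  refine ⟨B + B', fun m n => ?_⟩
  rw [birkhoffSum_shift hfg]
  have := hB n
  have := hB' m
  push_cast
  linarith
end Birkhoff
end BK

namespace BK
set_option linter.unusedSectionVars false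

section Words
variable {Ω : Type*} [MeasurableSpace Ω] {A : Type*} [Fintype A] [MeasurableSpace A]
  [MeasurableSingletonClass A]

lemma borelCantelli_moving {μ : Measure Ω} [IsProbabilityMeasure μ] {s : ℕ → Set Ω}
    {θ : ℕ → Ω → Ω} (hθ : ∀ n, MeasurePreserving (θ n) μ μ) {C c : ℝ} (hc : 0 < c)
    (hs : ∀ n, μ.real (s n) ≤ C * Real.exp (-c * n)) :
    ∀ᵐ x ∂μ, ∀ᶠ n in atTop, θ n x ∉ s n := by
  have hsum : Summable (fun n : ℕ => C * Real.exp (-c * n)) := by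
    refine Summable.mul_left C ?_
    have := Real.summable_exp_nat_mul_iff.2 (neg_lt_zero.2 hc)
    refine this.congr fun n => by rw [mul_comm]
  refine ae_eventually_notMem (s := fun n => θ n ⁻¹' s n) ?_
  refine ne_top_of_le_ne_top (hsum.tsum_ofReal_ne_top) (ENNReal.tsum_le_tsum fun n => ?_)
  refine ((hθ n).measure_preimage_le (s n)).trans ?_
  rw [← ENNReal.ofReal_toReal (measure_ne_top μ (s n))]
  exact ENNReal.ofReal_le_ofReal (hs n)

lemma integral_finite_comp {ι : Type*} [Fintype ι] [MeasurableSpace ι]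
    [MeasurableSingletonClass ι] {μ : Measure Ω} [IsFiniteMeasure μ] {Y : Ω → ι}
    (hY : Measurable Y) (F : ι → ℝ) :
    ∫ x, F (Y x) ∂μ = ∑ b, μ.real (Y ⁻¹' {b}) * F b := by
  have h1 : ∫ x, F (Y x) ∂μ = ∫ b, F b ∂(μ.map Y) := by
    rw [integral_map hY.aemeasurable]
    exact (Measurable.of_discrete (f := F)).aestronglyMeasurable
  have : IsFiniteMeasure (μ.map Y) := inferInstance
  rw [h1, integral_fintype Integrable.of_finite]
  refine Finset.sum_congr rfl fun b _ => ?_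
  rw [map_measureReal_apply hY (measurableSet_singleton b), smul_eq_mul]

lemma kraft {ι : Type*} [Fintype ι] {μ : Measure Ω} [IsProbabilityMeasure μ] {Y : Ω → ι}
    {r : ι → ℝ} (hr : ∀ b, 0 ≤ r b) {K c : ℝ} (hK : ∑ b, r b ≤ K) (hc : 0 ≤ c) :
    μ.real {x | μ.real (Y ⁻¹' {Y x}) < c * r (Y x)} ≤ c * K := by
  classical
  have hsub : {x | μ.real (Y ⁻¹' {Y x}) < c * r (Y x)} ⊆
      ⋃ b ∈ (Finset.univ.filter fun b => μ.real (Y ⁻¹' {b}) < c * r b), Y ⁻¹' {b} := by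
    intro x hx
    simp only [Set.mem_iUnion, Finset.mem_filter, Finset.mem_univ, true_and]
    exact ⟨Y x, hx, rfl⟩
  calc _ ≤ _ := measureReal_mono hsub (measure_ne_top _ _)
    _ ≤ ∑ b ∈ (Finset.univ.filter fun b => μ.real (Y ⁻¹' {b}) < c * r b), μ.real (Y ⁻¹' {b}) :=
        measureReal_biUnion_finset_le _ _
    _ ≤ ∑ b ∈ (Finset.univ.filter fun b => μ.real (Y ⁻¹' {b}) < c * r b), c * r b :=
        Finset.sum_le_sum fun b hb => (Finset.mem_filter.1 hb).2.le
    _ ≤ ∑ b, c * r b := Finset.sum_le_sum_of_subset_of_nonneg (Finset.subset_univ _)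
        (fun b _ _ => mul_nonneg hc (hr b))
    _ ≤ c * K := by rw [← Finset.mul_sum]; gcongr

lemma fiber_pos {ι : Type*} [Fintype ι] {μ : Measure Ω} [IsProbabilityMeasure μ] (Y : Ω → ι) :
    ∀ᵐ x ∂μ, 0 < μ.real (Y ⁻¹' {Y x}) := by
  have h : ∀ b : ι, ∀ᵐ x ∂μ, Y x = b → 0 < μ.real (Y ⁻¹' {b}) := by
    intro b
    by_cases hb : μ (Y ⁻¹' {b}) = 0
    · have : ∀ᵐ x ∂μ, x ∉ Y ⁻¹' {b} := measure_eq_zero_iff_ae_notMem.1 hb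
      filter_upwards [this] with x hx h
      exact absurd h hx
    · exact Eventually.of_forall fun x _ =>
        ENNReal.toReal_pos hb (measure_ne_top _ _)
  filter_upwards [ae_all_iff.2 h] with x hx
  exact hx _ rfl

/-- The word of length `n` read along the orbit of `x`. -/
def word (f : Ω → Ω) (ξ : Ω → A) (n : ℕ) (x : Ω) : Fin n → A := fun j => ξ (f^[j] x)

/-- Measure of the cell of `x`. -/
noncomputable def cm (μ : Measure Ω) (f : Ω → Ω) (ξ : Ω → A) (n : ℕ) (x : Ω) : ℝ :=
  μ.real (word f ξ n ⁻¹' {word f ξ n x})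

/-- Information function. -/
noncomputable def info (μ : Measure Ω) (f : Ω → Ω) (ξ : Ω → A) (n : ℕ) (x : Ω) : ℝ :=
  -Real.log (cm μ f ξ n x)

lemma word_measurable {f : Ω → Ω} {ξ : Ω → A} (hf : Measurable f) (hξ : Measurable ξ) (n : ℕ) :
    Measurable (word f ξ n) :=
  measurable_pi_lambda _ fun j => hξ.comp (hf.iterate j)

lemma info_nonneg (μ : Measure Ω) [IsProbabilityMeasure μ] (f : Ω → Ω) (ξ : Ω → A) (n : ℕ)
    (x : Ω) : 0 ≤ info μ f ξ n x := by
  unfold info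
  have := Real.log_nonpos (x := cm μ f ξ n x) measureReal_nonneg measureReal_le_one
  linarith

lemma info_measurable {μ : Measure Ω} {f : Ω → Ω} {ξ : Ω → A} (hf : Measurable f)
    (hξ : Measurable ξ) (n : ℕ) : Measurable (info μ f ξ n) := by
  have : info μ f ξ n = (fun w => -Real.log (μ.real (word f ξ n ⁻¹' {w}))) ∘ word f ξ n := rfl
  rw [this]
  exact Measurable.of_discrete.comp (word_measurable hf hξ n)

lemma info_integrable {μ : Measure Ω} [IsProbabilityMeasure μ] {f : Ω → Ω} {ξ : Ω → A}
    (hf : Measurable f) (hξ : Measurable ξ) (n : ℕ) : Integrable (info μ f ξ n) μ := by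
  have h : info μ f ξ n = (fun w => -Real.log (μ.real (word f ξ n ⁻¹' {w}))) ∘ word f ξ n := rfl
  rw [h]
  refine Integrable.comp_measurable ?_ (word_measurable hf hξ n)
  exact Integrable.of_finite

lemma upper_block {μ : Measure Ω} [IsProbabilityMeasure μ] (f : Ω → Ω) (ξ : Ω → A)
    (k m : ℕ) (δ : ℝ) (hf : Measurable f) (hξ : Measurable ξ) :
    μ.real {y | μ.real ((fun z => (fun i : Fin m => word f ξ k (f^[i * k] z))) ⁻¹'
        {fun i : Fin m => word f ξ k (f^[i * k] y)})
        < Real.exp (-δ * m) * ∏ i : Fin m, cm μ f ξ k (f^[i * k] y)} ≤ Real.exp (-δ * m) := by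
  have h := kraft (μ := μ) (Y := fun z => (fun i : Fin m => word f ξ k (f^[i * k] z)))
    (r := fun w => ∏ i : Fin m, μ.real (word f ξ k ⁻¹' {w i})) (K := 1)
    (c := Real.exp (-δ * m)) (fun b => Finset.prod_nonneg fun i _ => measureReal_nonneg) ?_
    (Real.exp_pos _).le
  · rw [mul_one] at h
    exact h
  · rw [← Fintype.prod_sum (fun (_ : Fin m) (b : Fin k → A) => μ.real (word f ξ k ⁻¹' {b}))]
    have := integral_finite_comp (μ := μ) (word_measurable hf hξ k) (fun _ => (1:ℝ))
    simp only [mul_one, integral_const, probReal_univ, smul_eq_mul] at this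
    rw [← this]; simp

lemma block_sub {μ : Measure Ω} [IsProbabilityMeasure μ] {f : Ω → Ω} {ξ : Ω → A}
    (hf : MeasurePreserving f μ μ) (hξ : Measurable ξ)
    {k m r N : ℕ} (hk : 0 < k) (h : r + N ≤ m * k) (y : Ω) :
    μ.real ((fun z => (fun i : Fin m => word f ξ k (f^[i * k] z))) ⁻¹'
        {fun i : Fin m => word f ξ k (f^[i * k] y)}) ≤ cm μ f ξ N (f^[r] y) := by
  have hm : MeasurableSet (word f ξ N ⁻¹' {word f ξ N (f^[r] y)}) :=
    word_measurable hf.measurable hξ N (measurableSet_singleton _)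
  unfold cm
  rw [← (hf.iterate r).measureReal_preimage hm.nullMeasurableSet]
  refine measureReal_mono ?_
  intro z hz
  simp only [Set.mem_preimage, Set.mem_singleton_iff] at hz ⊢
  funext j
  have hlt : (r + j) / k < m := by
    rw [Nat.div_lt_iff_lt_mul hk]
    have := j.2
    omega
  have h1 := congrFun (congrFun hz ⟨(r + j) / k, hlt⟩) ⟨(r + j) % k, Nat.mod_lt _ hk⟩
  simp only [word, ← Function.iterate_add_apply] at h1 ⊢
  have e : (r + j) % k + (r + j) / k * k = j + r := by
    rw [mul_comm, Nat.mod_add_div, add_comm]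
  rw [e] at h1
  exact h1

lemma sum_range_mul (φ : ℕ → ℝ) (k m : ℕ) :
    ∑ j ∈ Finset.range (m * k), φ j = ∑ s ∈ Finset.range k, ∑ i ∈ Finset.range m, φ (i * k + s) := by
  rw [Finset.sum_comm]
  induction m with
  | zero => simp
  | succ m ih =>
    rw [Finset.sum_range_succ, ← ih, Nat.succ_mul, Finset.sum_range_add]

lemma upper_smb {μ : Measure Ω} [IsProbabilityMeasure μ] {f g : Ω → Ω} {ξ : Ω → A}
    (hf : Ergodic f μ) (hg : Ergodic g μ) (hfg : ∀ x, f (g x) = x) (hξ : Measurable ξ)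
    {k : ℕ} (hk : 0 < k) {c : ℝ} (hc : ∫ x, info μ f ξ k x ∂μ < c) :
    ∀ᵐ x ∂μ, ∀ᶠ n : ℕ in atTop, (k : ℝ) * info μ f ξ (2 * n + 1) (g^[n] x) ≤ 2 * n * c := by
  have hinv : Function.LeftInverse f g := hfg
  have hmf := hf.toMeasurePreserving
  have hmg := hg.toMeasurePreserving
  have hH0 : 0 ≤ ∫ x, info μ f ξ k x ∂μ := integral_nonneg fun x => info_nonneg μ f ξ k x
  obtain ⟨c', hc1, hc2⟩ := exists_between hc
  set δ := (c - c') / 2 with hδ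
  have hδ0 : 0 < δ := by rw [hδ]; linarith
  have hk' : (0:ℝ) < k := Nat.cast_pos.2 hk
  -- positivity along orbits
  have hpos : ∀ᵐ x ∂μ, ∀ n j : ℕ, 0 < cm μ f ξ k (f^[j] (g^[n] x)) := by
    refine ae_all_iff.2 fun n => ae_all_iff.2 fun j => ?_
    have h0 : ∀ᵐ x ∂μ, 0 < cm μ f ξ k x := fiber_pos (word f ξ k)
    exact (((hmf.iterate j).comp (hmg.iterate n)).quasiMeasurePreserving).ae h0
  -- Borel-Cantelli
  have hbc : ∀ᵐ x ∂μ, ∀ s : Fin k, ∀ᶠ n : ℕ in atTop, f^[s] (g^[n + k] x) ∉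
      {y | μ.real ((fun z => (fun i : Fin (2 * n / k + 2) => word f ξ k (f^[i * k] z))) ⁻¹'
        {fun i : Fin (2 * n / k + 2) => word f ξ k (f^[i * k] y)})
        < Real.exp (-δ * (2 * n / k + 2 : ℕ)) *
          ∏ i : Fin (2 * n / k + 2), cm μ f ξ k (f^[i * k] y)} := by
    refine ae_all_iff.2 fun s => ?_
    refine borelCantelli_moving (θ := fun n x => f^[s] (g^[n + k] x)) (C := 1) (c := δ / k)
      (fun n => (hmf.iterate s).comp (hmg.iterate (n + k))) (by positivity) (fun n => ?_)
    refine (upper_block f ξ k (2 * n / k + 2) δ hf.measurable hξ).trans ?_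
    rw [one_mul, Real.exp_le_exp]
    have h1 : n ≤ (2 * n / k + 2) * k := by
      have := Nat.lt_div_mul_add (a := 2 * n) hk
      nlinarith
    have h2 : (n : ℝ) ≤ (2 * n / k + 2 : ℕ) * k := by exact_mod_cast h1
    have h3 : (n : ℝ) / k ≤ (2 * n / k + 2 : ℕ) := by rwa [div_le_iff₀ hk']
    have : δ * ((n : ℝ) / k) ≤ δ * (2 * n / k + 2 : ℕ) := by gcongr
    calc _ ≤ -(δ * ((n : ℝ) / k)) := by linarith
      _ = _ := by ring
  filter_upwards [hpos, hbc, birkhoff_two_le hf hg hfg (info_measurable hf.measurable hξ k)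
    (info_integrable hf.measurable hξ k) hc1] with x hx1 hx2 ⟨B, hB⟩
  have hev : ∀ᶠ n : ℕ in atTop, (2 * n + 2 * k) * (c' + δ) + B ≤ 2 * n * c := by
    have : Tendsto (fun n : ℕ => (n : ℝ)) atTop atTop := tendsto_natCast_atTop_atTop
    filter_upwards [this.eventually_ge_atTop ((2 * k * (c' + δ) + B) / (2 * δ))] with n hn
    rw [div_le_iff₀ (by positivity)] at hn
    have : c = c' + 2 * δ := by rw [hδ]; ring
    rw [this]; nlinarith
  filter_upwards [hev, eventually_all.2 hx2] with n hn1 hn2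
  set m := 2 * n / k + 2 with hm
  have hmk1 : 2 * n + 1 + k ≤ m * k := by
    have := Nat.lt_div_mul_add (a := 2 * n) hk
    rw [hm]; nlinarith
  have hmk2 : m * k ≤ 2 * n + 2 * k := by
    have := Nat.div_mul_le_self (2 * n) k
    rw [hm]; nlinarith
  set y := g^[n + k] x with hy
  have key : ∀ s ∈ Finset.range k, info μ f ξ (2 * n + 1) (g^[n] x) ≤
      δ * m + ∑ i ∈ Finset.range m, info μ f ξ k (f^[i * k + s] y) := by
    intro s hs
    have hs' := Finset.mem_range.1 hs
    have h1 := hn2 ⟨s, hs'⟩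
    simp only [not_lt] at h1
    have h2 := h1.trans (block_sub (r := k - s) (N := 2 * n + 1) hmf hξ hk (by omega) _)
    have e : f^[k - s] (f^[s] y) = g^[n] x := by
      rw [← Function.iterate_add_apply, Nat.sub_add_cancel hs'.le, hy, add_comm n k,
        Function.iterate_add_apply, hinv.iterate k]
    rw [e] at h2
    have e3 : ∀ i : Fin m, f^[i * k] (f^[s] y) = f^[i * k + s] y := fun i =>
      (Function.iterate_add_apply _ _ _ _).symm
    simp_rw [e3] at h2
    have hpp : ∀ i : Fin m, 0 < cm μ f ξ k (f^[i * k + s] y) := fun i => hx1 _ _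
    have h3 := Real.log_le_log (mul_pos (Real.exp_pos _)
      (Finset.prod_pos fun i _ => hpp i)) h2
    rw [Real.log_mul (Real.exp_pos _).ne' (Finset.prod_pos fun i _ => hpp i).ne', Real.log_exp,
      Real.log_prod (fun i _ => (hpp i).ne')] at h3
    rw [Finset.sum_range (fun i => info μ f ξ k (f^[i * k + s] y))]
    simp only [info, Finset.sum_neg_distrib]
    linarith
  have hsum := Finset.sum_le_sum key
  rw [Finset.sum_const, Finset.card_range, nsmul_eq_mul, Finset.sum_add_distrib, Finset.sum_const,
    Finset.card_range, nsmul_eq_mul, ← sum_range_mul (fun j => info μ f ξ k (f^[j] y))] at hsum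
  have hB' := hB (n + k) (m * k - (n + k))
  rw [Nat.add_sub_cancel' (by omega)] at hB'
  unfold birkhoffSum at hB'
  have hmk3 : ((m * k : ℕ) : ℝ) ≤ 2 * n + 2 * k := by exact_mod_cast hmk2
  have h5 : ((m * k : ℕ) : ℝ) * (c' + δ) ≤ (2 * n + 2 * k) * (c' + δ) := by
    have : 0 ≤ c' + δ := by linarith
    gcongr
  push_cast at h5 hB' hmk3
  nlinarith
end Words
end BK

namespace BK
set_option linter.unusedSectionVars false

section Chain
variable {Ω : Type*} [m0 : MeasurableSpace Ω] {A : Type*} [Fintype A] [MeasurableSpace A]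
  [MeasurableSingletonClass A]

/-- Conditional probability of `X = a` given the value of `Y`. -/
noncomputable def ratio {ι : Type*} (μ : Measure Ω) (X : Ω → A) (Y : Ω → ι) (a : A) (b : ι) : ℝ :=
  μ.real (X ⁻¹' {a} ∩ Y ⁻¹' {b}) / μ.real (Y ⁻¹' {b})

lemma condExp_ratio {ι : Type*} [Fintype ι] [mι : MeasurableSpace ι]
    [MeasurableSingletonClass ι] {μ : Measure Ω} [IsProbabilityMeasure μ] {X : Ω → A} {Y : Ω → ι}
    (hX : Measurable X) (hY : Measurable Y) (a : A) :
    μ[(X ⁻¹' {a}).indicator (fun _ => (1:ℝ)) | mι.comap Y] =ᵐ[μ] fun x => ratio μ X Y a (Y x) := by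
  classical
  have hXa : MeasurableSet (X ⁻¹' {a}) := hX (measurableSet_singleton a)
  have hle : mι.comap Y ≤ m0 := hY.comap_le
  have hInt : Integrable (fun x => ratio μ X Y a (Y x)) μ :=
    (Integrable.of_finite (f := ratio μ X Y a) (μ := μ.map Y)).comp_measurable hY
  symm
  refine ae_eq_condExp_of_forall_setIntegral_eq hle ?_ ?_ ?_ ?_
  · exact (integrable_const (1:ℝ)).indicator hXa
  · intro s _ _
    exact hInt.integrableOn
  · rintro s ⟨S, hS, rfl⟩ _
    have h1 : ∫ x in Y ⁻¹' S, ratio μ X Y a (Y x) ∂μ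
        = ∫ x, (S.indicator (ratio μ X Y a)) (Y x) ∂μ := by
      rw [← integral_indicator (hY hS)]
      rfl
    have h2 : ∫ x in Y ⁻¹' S, (X ⁻¹' {a}).indicator (fun _ => (1:ℝ)) x ∂μ
        = ∫ x, (S.indicator (fun _ => (1:ℝ))) (Y x) ∂(μ.restrict (X ⁻¹' {a})) := by
      rw [← integral_indicator (hY hS), ← integral_indicator hXa]
      congr 1
      ext x
      by_cases h1 : x ∈ X ⁻¹' {a} <;> by_cases h2 : Y x ∈ S <;>
        simp [Set.indicator, h1, h2]
    rw [h1, h2, integral_finite_comp hY, integral_finite_comp hY]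
    refine Finset.sum_congr rfl fun b _ => ?_
    rw [measureReal_restrict_apply (hY (measurableSet_singleton b))]
    by_cases hb : b ∈ S
    · simp only [Set.indicator_of_mem hb, ratio, mul_one]
      rw [Set.inter_comm (Y ⁻¹' {b})]
      by_cases h0 : μ.real (Y ⁻¹' {b}) = 0
      · have : μ.real (X ⁻¹' {a} ∩ Y ⁻¹' {b}) = 0 :=
          le_antisymm (h0 ▸ measureReal_mono Set.inter_subset_right) measureReal_nonneg
        rw [this, h0]; simp
      · field_simp
    · simp [hb]
  · refine StronglyMeasurable.aestronglyMeasurable ?_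
    refine Measurable.stronglyMeasurable ?_
    exact (Measurable.of_discrete (f := ratio μ X Y a)).comp (comap_measurable Y)

lemma chain_rule {ι : Type*} [Fintype ι] [MeasurableSpace ι]
    [MeasurableSingletonClass ι] {μ : Measure Ω} [IsProbabilityMeasure μ] {X : Ω → A} {Y : Ω → ι}
    (hX : Measurable X) (hY : Measurable Y) :
    ∑ a, ∫ x, Real.negMulLog (ratio μ X Y a (Y x)) ∂μ =
      (∑ a, ∑ b, Real.negMulLog (μ.real (X ⁻¹' {a} ∩ Y ⁻¹' {b})))
        - ∑ b, Real.negMulLog (μ.real (Y ⁻¹' {b})) := by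
  have hpt : ∀ a b, μ.real (Y ⁻¹' {b}) * Real.negMulLog (ratio μ X Y a b)
      = Real.negMulLog (μ.real (X ⁻¹' {a} ∩ Y ⁻¹' {b})) +
        μ.real (X ⁻¹' {a} ∩ Y ⁻¹' {b}) * Real.log (μ.real (Y ⁻¹' {b})) := by
    intro a b
    unfold ratio Real.negMulLog
    by_cases h0 : μ.real (Y ⁻¹' {b}) = 0
    · have : μ.real (X ⁻¹' {a} ∩ Y ⁻¹' {b}) = 0 :=
        le_antisymm (h0 ▸ measureReal_mono Set.inter_subset_right) measureReal_nonneg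
      rw [this, h0]; simp
    · by_cases h1 : μ.real (X ⁻¹' {a} ∩ Y ⁻¹' {b}) = 0
      · rw [h1]; simp
      · rw [Real.log_div h1 h0]; field_simp; ring
  have hsum : ∀ b, ∑ a, μ.real (X ⁻¹' {a} ∩ Y ⁻¹' {b}) = μ.real (Y ⁻¹' {b}) := by
    intro b
    have := integral_finite_comp (μ := μ.restrict (Y ⁻¹' {b})) hX (fun _ => (1:ℝ))
    simp only [mul_one, integral_const, smul_eq_mul] at this
    rw [measureReal_restrict_apply MeasurableSet.univ, Set.univ_inter] at this
    rw [this]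
    exact Finset.sum_congr rfl fun a _ => (measureReal_restrict_apply
      (hX (measurableSet_singleton a))).symm
  have h1 : ∀ a, ∫ x, Real.negMulLog (ratio μ X Y a (Y x)) ∂μ =
      ∑ b, (Real.negMulLog (μ.real (X ⁻¹' {a} ∩ Y ⁻¹' {b})) +
        μ.real (X ⁻¹' {a} ∩ Y ⁻¹' {b}) * Real.log (μ.real (Y ⁻¹' {b}))) := by
    intro a
    rw [integral_finite_comp hY (fun b => Real.negMulLog (ratio μ X Y a b))]
    exact Finset.sum_congr rfl fun b _ => hpt a b
  simp_rw [h1, Finset.sum_add_distrib]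
  rw [sub_eq_add_neg, ← Finset.sum_neg_distrib]
  congr 1
  rw [Finset.sum_comm]
  refine Finset.sum_congr rfl fun b _ => ?_
  rw [← Finset.sum_mul, hsum, Real.negMulLog]; ring

lemma info_integral {μ : Measure Ω} [IsProbabilityMeasure μ] {f : Ω → Ω} {ξ : Ω → A}
    (hf : Measurable f) (hξ : Measurable ξ) (n : ℕ) :
    ∫ x, info μ f ξ n x ∂μ = ∑ w, Real.negMulLog (μ.real (word f ξ n ⁻¹' {w})) := by
  have := integral_finite_comp (μ := μ) (word_measurable hf hξ n)
    (fun w => -Real.log (μ.real (word f ξ n ⁻¹' {w})))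
  refine this.trans (Finset.sum_congr rfl fun w _ => ?_)
  rw [Real.negMulLog]; ring

lemma info_succ {μ : Measure Ω} [IsProbabilityMeasure μ] {f : Ω → Ω} {ξ : Ω → A}
    (hf : MeasurePreserving f μ μ) (hξ : Measurable ξ) (n : ℕ) :
    ∑ a, ∫ x, Real.negMulLog (ratio μ ξ (fun y => word f ξ n (f y)) a (word f ξ n (f x))) ∂μ =
      ∫ x, info μ f ξ (n + 1) x ∂μ - ∫ x, info μ f ξ n x ∂μ := by
  have hY : Measurable (fun y => word f ξ n (f y)) :=
    (word_measurable hf.measurable hξ n).comp hf.measurable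
  rw [info_integral hf.measurable hξ, info_integral hf.measurable hξ,
    chain_rule hξ hY]
  congr 1
  · rw [← Fintype.sum_prod_type']
    refine Fintype.sum_equiv (Fin.consEquiv (fun _ => A)) _ _ ?_
    rintro ⟨a, w⟩
    congr 2
    ext x
    simp only [Set.mem_inter_iff, Set.mem_preimage, Set.mem_singleton_iff, Fin.consEquiv,
      Equiv.coe_fn_mk, funext_iff, Fin.forall_fin_succ, word]
    simp
  · refine Finset.sum_congr rfl fun w _ => ?_
    congr 1
    exact hf.measureReal_preimage
      (word_measurable hf.measurable hξ n (measurableSet_singleton w)).nullMeasurableSet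

/-- The filtration of finite futures. -/
def futFil {f : Ω → Ω} {ξ : Ω → A} (hf : Measurable f) (hξ : Measurable ξ) :
    Filtration ℕ m0 where
  seq n := MeasurableSpace.comap (fun x => word f ξ n (f x)) inferInstance
  mono' := by
    intro m n hmn
    have : (fun x => word f ξ m (f x)) = (fun w : Fin n → A => fun j : Fin m => w (Fin.castLE hmn j))
        ∘ (fun x => word f ξ n (f x)) := rfl
    beta_reduce
    rw [this, ← MeasurableSpace.comap_comp]
    exact MeasurableSpace.comap_mono (Measurable.of_discrete).comap_le
  le' n := ((word_measurable hf hξ n).comp hf).comap_le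

/-- Conditional probability of the present symbol given the infinite future. -/
noncomputable def pinf (μ : Measure Ω) {f : Ω → Ω} {ξ : Ω → A} (hf : Measurable f)
    (hξ : Measurable ξ) (a : A) : Ω → ℝ :=
  μ[(ξ ⁻¹' {a}).indicator (fun _ => (1:ℝ)) | ⨆ n, futFil hf hξ n]

lemma condExp_ind_mem {μ : Measure Ω} [IsProbabilityMeasure μ] {s : Set Ω} (hs : MeasurableSet s)
    (m : MeasurableSpace Ω) (hm : m ≤ m0) :
    ∀ᵐ x ∂μ, μ[s.indicator (fun _ => (1:ℝ)) | m] x ∈ Set.Icc (0:ℝ) 1 := by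
  have hi : Integrable (s.indicator (fun _ => (1:ℝ))) μ := (integrable_const (1:ℝ)).indicator hs
  have h1 := condExp_mono (m := m) (integrable_const (0:ℝ)) hi
    (Eventually.of_forall fun x => Set.indicator_nonneg (fun _ _ => zero_le_one) x)
  have h2 := condExp_mono (m := m) hi (integrable_const (1:ℝ))
    (Eventually.of_forall fun x => Set.indicator_le_self' (fun _ _ => zero_le_one) x)
  rw [condExp_const hm] at h1 h2
  filter_upwards [h1, h2] with x h1 h2
  exact ⟨h1, h2⟩

lemma negMulLog_abs_le {t : ℝ} (ht : t ∈ Set.Icc (0:ℝ) 1) : ‖Real.negMulLog t‖ ≤ 1 := by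
  rw [Real.norm_eq_abs, abs_of_nonneg (Real.negMulLog_nonneg ht.1 ht.2)]
  linarith [Real.negMulLog_le_one_sub_self ht.1, ht.1]

lemma entropy_tendsto {μ : Measure Ω} [IsProbabilityMeasure μ] {f : Ω → Ω} {ξ : Ω → A}
    (hf : MeasurePreserving f μ μ) (hξ : Measurable ξ) :
    Tendsto (fun n : ℕ => (∫ x, info μ f ξ n x ∂μ) / n) atTop
      (nhds (∑ a, ∫ x, Real.negMulLog (pinf μ hf.measurable hξ a x) ∂μ)) := by
  have hstep : Tendsto (fun n : ℕ => ∫ x, info μ f ξ (n + 1) x ∂μ - ∫ x, info μ f ξ n x ∂μ) atTop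
      (nhds (∑ a, ∫ x, Real.negMulLog (pinf μ hf.measurable hξ a x) ∂μ)) := by
    simp_rw [← info_succ hf hξ]
    refine tendsto_finsetSum _ fun a _ => ?_
    have hset : MeasurableSet (ξ ⁻¹' {a}) := hξ (measurableSet_singleton a)
    have heq : ∀ n, ∀ᵐ x ∂μ, μ[(ξ ⁻¹' {a}).indicator (fun _ => (1:ℝ)) | futFil hf.measurable hξ n] x
        = ratio μ ξ (fun y => word f ξ n (f y)) a (word f ξ n (f x)) := fun n =>
      condExp_ratio hξ ((word_measurable hf.measurable hξ n).comp hf.measurable) a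
    refine tendsto_integral_of_dominated_convergence (fun _ => (1:ℝ)) ?_ (integrable_const _) ?_ ?_
    · intro n
      exact ((Measurable.of_discrete (f := fun w => Real.negMulLog
        (ratio μ ξ (fun y => word f ξ n (f y)) a w))).comp
        ((word_measurable hf.measurable hξ n).comp hf.measurable)).aestronglyMeasurable
    · intro n
      filter_upwards [heq n, condExp_ind_mem (μ := μ) hset _ ((futFil hf.measurable hξ).le n)]
        with x h1 h2
      rw [h1] at h2
      exact negMulLog_abs_le h2
    · filter_upwards [ae_all_iff.2 heq, tendsto_ae_condExp (μ := μ) (ℱ := futFil hf.measurable hξ)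
        ((ξ ⁻¹' {a}).indicator (fun _ => (1:ℝ)))] with x h1 h2
      simp_rw [h1] at h2
      exact (Real.continuous_negMulLog.tendsto _).comp h2
  have hces := hstep.cesaro
  refine hces.congr fun n => ?_
  rw [Finset.sum_range_sub (fun n => ∫ x, info μ f ξ n x ∂μ)]
  have h0 : ∫ x, info μ f ξ 0 x ∂μ = 0 := by
    have : ∀ x, info μ f ξ 0 x = 0 := by
      intro x
      have : word f ξ 0 ⁻¹' {word f ξ 0 x} = Set.univ := by
        ext y; simp [Subsingleton.elim (word f ξ 0 y) (word f ξ 0 x)]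
      simp [info, cm, this]
    simp [this]
  rw [h0, sub_zero]
  field_simp
end Chain
end BK

namespace BK
set_option linter.unusedSectionVars false

section Lower
variable {Ω : Type*} {m m0 : MeasurableSpace Ω} {A : Type*} [Fintype A] [MeasurableSpace A]
  [MeasurableSingletonClass A]

lemma pull_out {μ : Measure Ω} [IsProbabilityMeasure μ] {s : Set Ω} (hs : MeasurableSet s)
    (hm : m ≤ m0) {v : Ω → ℝ≥0∞} (hv : Measurable[m] v) :
    ∫⁻ x in s, v x ∂μ
      = ∫⁻ x, ENNReal.ofReal (μ[s.indicator (fun _ => (1:ℝ)) | m] x) * v x ∂μ := by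
  set p := μ[s.indicator (fun _ => (1:ℝ)) | m] with hp
  have hpm : Measurable[m] p := stronglyMeasurable_condExp.measurable
  have hpm0 : Measurable p := hpm.mono hm le_rfl
  have hmeas : (μ.restrict s).trim hm = (μ.withDensity (fun x => ENNReal.ofReal (p x))).trim hm := by
    refine @Measure.ext _ m _ _ fun t ht => ?_
    rw [trim_measurableSet_eq hm ht, trim_measurableSet_eq hm ht, Measure.restrict_apply (hm t ht),
      withDensity_apply _ (hm t ht)]
    have hi : Integrable (s.indicator (fun _ => (1:ℝ))) μ := (integrable_const (1:ℝ)).indicator hs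
    have h1 := setIntegral_condExp hm hi ht
    have h2 : ∫ x in t, s.indicator (fun _ => (1:ℝ)) x ∂μ = μ.real (t ∩ s) := by
      rw [setIntegral_indicator hs]; simp
    rw [← ofReal_integral_eq_lintegral_ofReal integrable_condExp.integrableOn, h1, h2,
      ofReal_measureReal]
    refine ae_restrict_of_ae ?_
    filter_upwards [condExp_ind_mem (μ := μ) hs m hm] with x hx
    exact hx.1
  rw [← lintegral_trim hm hv, hmeas, lintegral_trim hm hv,
    lintegral_withDensity_eq_lintegral_mul _ hpm0.ennreal_ofReal (hv.mono hm le_rfl)]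
  rfl

/-- Truncated information of the present symbol given the future, with truncation level `τ`. -/
noncomputable def psi (p : A → Ω → ℝ) (ξ : Ω → A) (τ : ℝ) (x : Ω) : ℝ :=
  -Real.log (max (p (ξ x) x) τ)

lemma psi_measurable {p : A → Ω → ℝ} {ξ : Ω → A} (hp : ∀ a, Measurable (p a)) (hξ : Measurable ξ)
    (τ : ℝ) : Measurable (psi p ξ τ) := by
  classical
  have : Measurable (fun x => p (ξ x) x) := by
    have h : (fun x => p (ξ x) x) = fun x => ∑ a, (ξ ⁻¹' {a}).indicator (p a) x := by
      ext x
      rw [Finset.sum_eq_single (ξ x)]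
      · simp
      · intro b _ hb
        have : x ∉ ξ ⁻¹' {b} := fun h => hb (by simpa using h.symm)
        simp [this]
      · simp
    rw [h]
    exact Finset.measurable_sum _ fun a _ => (hp a).indicator (hξ (measurableSet_singleton a))
  exact (this.max measurable_const).log.neg

/-- The weighted indicator of a cell. -/
noncomputable def Vw (f : Ω → Ω) (ξ : Ω → A) (p : A → Ω → ℝ) (τ : ℝ) (n : ℕ) (w : Fin n → A) :
    Ω → ℝ≥0∞ :=
  (word f ξ n ⁻¹' {w}).indicator fun x => ENNReal.ofReal (Real.exp (birkhoffSum f (psi p ξ τ) n x))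

lemma Vw_succ (f : Ω → Ω) (ξ : Ω → A) (p : A → Ω → ℝ) {τ : ℝ} (hτ : 0 < τ) (n : ℕ)
    (w : Fin (n + 1) → A) (x : Ω) :
    Vw f ξ p τ (n + 1) w x = (ξ ⁻¹' {w 0}).indicator
      (fun x => ENNReal.ofReal ((max (p (w 0) x) τ)⁻¹) * Vw f ξ p τ n (Fin.tail w) (f x)) x := by
  have hmem : x ∈ word f ξ (n + 1) ⁻¹' {w} ↔
      x ∈ ξ ⁻¹' {w 0} ∧ f x ∈ word f ξ n ⁻¹' {Fin.tail w} := by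
    simp only [Set.mem_preimage, Set.mem_singleton_iff, funext_iff, Fin.forall_fin_succ, word,
      Fin.tail]
    simp
  unfold Vw
  by_cases h1 : x ∈ ξ ⁻¹' {w 0}
  · by_cases h2 : f x ∈ word f ξ n ⁻¹' {Fin.tail w}
    · rw [Set.indicator_of_mem (hmem.2 ⟨h1, h2⟩), Set.indicator_of_mem h1,
        Set.indicator_of_mem h2, birkhoffSum_succ', Real.exp_add,
        ENNReal.ofReal_mul (Real.exp_pos _).le]
      congr 2
      have : ξ x = w 0 := h1
      rw [psi, this, ← Real.log_inv, Real.exp_log]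
      have : 0 < max (p (w 0) x) τ := lt_max_of_lt_right hτ
      positivity
    · rw [Set.indicator_of_notMem (fun h => h2 (hmem.1 h).2), Set.indicator_of_mem h1,
        Set.indicator_of_notMem h2, mul_zero]
  · rw [Set.indicator_of_notMem (fun h => h1 (hmem.1 h).1), Set.indicator_of_notMem h1]

lemma Vw_measurable (f : Ω → Ω) (ξ : Ω → A) (p : A → Ω → ℝ) {τ : ℝ} (hτ : 0 < τ)
    (hf : Measurable[m, m] f) (hξ : Measurable[m] (fun x => ξ (f x)))
    (hp : ∀ a, Measurable[m] (p a)) (n : ℕ) (w : Fin n → A) :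
    Measurable[m] (fun x => Vw f ξ p τ n w (f x)) := by
  induction n with
  | zero =>
    have : ∀ x, Vw f ξ p τ 0 w (f x) = 1 := by
      intro x
      have : f x ∈ word f ξ 0 ⁻¹' {w} := Subsingleton.elim _ _
      simp [Vw, this]
    simp_rw [this]
    exact measurable_const
  | succ n ih =>
    have h2 : ∀ x, Vw f ξ p τ (n + 1) w (f x) = ((fun x => ξ (f x)) ⁻¹' {w 0}).indicator
      (fun x => ENNReal.ofReal ((max (p (w 0) (f x)) τ)⁻¹) *
        Vw f ξ p τ n (Fin.tail w) (f (f x))) x := by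
      intro x
      rw [Vw_succ f ξ p hτ]
      rfl
    simp_rw [h2]
    refine Measurable.indicator ?_ (hξ (measurableSet_singleton _))
    exact ((((hp (w 0)).comp hf).max measurable_const).inv.ennreal_ofReal).mul ((ih _).comp hf)

lemma Vw_lintegral_le {μ : Measure Ω} [IsProbabilityMeasure μ] {f : Ω → Ω} {ξ : Ω → A}
    {p : A → Ω → ℝ} {τ : ℝ} (hτ : 0 < τ)
    (hfm : MeasurePreserving f μ μ) (hξm : Measurable ξ)
    (hm : m ≤ m0) (hf : Measurable[m, m] f)
    (hξ : Measurable[m] (fun x => ξ (f x)))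
    (hp : ∀ a, p a = μ[(ξ ⁻¹' {a}).indicator (fun _ => (1:ℝ)) | m]) (n : ℕ) (w : Fin n → A) :
    ∫⁻ x, Vw f ξ p τ n w x ∂μ ≤ 1 := by
  have hpm : ∀ a, Measurable[m] (p a) := fun a => by
    rw [hp a]; exact stronglyMeasurable_condExp.measurable
  have hpm0 : ∀ a, Measurable (p a) := fun a => (hpm a).mono hm le_rfl
  have hVm : ∀ (n : ℕ) (w : Fin n → A), Measurable (Vw f ξ p τ n w) := by
    intro n w
    refine Measurable.indicator ?_ (word_measurable hfm.measurable hξm n (measurableSet_singleton _))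
    refine (Measurable.exp ?_).ennreal_ofReal
    exact Finset.measurable_sum _ fun k _ =>
      (psi_measurable hpm0 hξm τ).comp (hfm.measurable.iterate k)
  induction n with
  | zero =>
    refine (lintegral_mono (g := fun _ => 1) fun x => ?_).trans (by simp)
    unfold Vw
    refine (Set.indicator_le_self _ _ _).trans ?_
    simp
  | succ n ih =>
    simp_rw [Vw_succ f ξ p hτ]
    rw [lintegral_indicator (hξm (measurableSet_singleton _)),
      pull_out (hξm (measurableSet_singleton _)) hm]
    · calc _ ≤ ∫⁻ x, Vw f ξ p τ n (Fin.tail w) (f x) ∂μ := by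
            refine lintegral_mono fun x => ?_
            rw [← hp, ← mul_assoc]
            refine mul_le_of_le_one_left' ?_
            have h0 : 0 < max (p (w 0) x) τ := lt_max_of_lt_right hτ
            rw [← ENNReal.ofReal_mul' (by positivity), ENNReal.ofReal_le_one,
              ← div_eq_mul_inv, div_le_one h0]
            exact le_max_left _ _
        _ = ∫⁻ x, Vw f ξ p τ n (Fin.tail w) x ∂μ := hfm.lintegral_comp (hVm _ _)
        _ ≤ 1 := ih _
    · exact (((hpm (w 0)).max measurable_const).inv.ennreal_ofReal).mul
        (Vw_measurable f ξ p hτ hf hξ hpm n _)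

lemma lower_block {μ : Measure Ω} [IsProbabilityMeasure μ] {f : Ω → Ω} {ξ : Ω → A}
    {p : A → Ω → ℝ} {τ : ℝ} (hτ : 0 < τ)
    (hfm : MeasurePreserving f μ μ) (hξm : Measurable ξ)
    (hm : m ≤ m0) (hf : Measurable[m, m] f)
    (hξ : Measurable[m] (fun x => ξ (f x)))
    (hp : ∀ a, p a = μ[(ξ ⁻¹' {a}).indicator (fun _ => (1:ℝ)) | m]) (n : ℕ) (δ : ℝ) :
    μ.real {x | Real.exp (δ * n - birkhoffSum f (psi p ξ τ) n x) ≤ cm μ f ξ n x}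
      ≤ Real.exp (-δ * n) := by
  set S := {x | Real.exp (δ * n - birkhoffSum f (psi p ξ τ) n x) ≤ cm μ f ξ n x} with hS
  have hpm0 : ∀ a, Measurable (p a) := fun a => by
    rw [hp a]; exact (stronglyMeasurable_condExp.mono hm).measurable
  have hVm : ∀ (w : Fin n → A), Measurable (Vw f ξ p τ n w) := by
    intro w
    refine Measurable.indicator ?_ (word_measurable hfm.measurable hξm n (measurableSet_singleton _))
    refine (Measurable.exp ?_).ennreal_ofReal
    exact Finset.measurable_sum _ fun k _ =>
      (psi_measurable hpm0 hξm τ).comp (hfm.measurable.iterate k)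
  have hw : ∀ w : Fin n → A, μ.real (S ∩ word f ξ n ⁻¹' {w}) ≤
      Real.exp (-δ * n) * μ.real (word f ξ n ⁻¹' {w}) := by
    intro w
    by_cases h0 : μ.real (word f ξ n ⁻¹' {w}) = 0
    · rw [h0, mul_zero]
      exact h0 ▸ measureReal_mono Set.inter_subset_right
    have hpos : 0 < μ.real (word f ξ n ⁻¹' {w}) := lt_of_le_of_ne measureReal_nonneg (Ne.symm h0)
    set κ := Real.exp (δ * n) / μ.real (word f ξ n ⁻¹' {w}) with hκ
    have hκ0 : 0 < κ := by positivity
    have hsub : S ∩ word f ξ n ⁻¹' {w} ⊆ {x | ENNReal.ofReal κ ≤ Vw f ξ p τ n w x} := by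
      rintro x ⟨hx1, hx2⟩
      have hx3 : word f ξ n x = w := hx2
      simp only [hS, Set.mem_ofPred_eq, cm, hx3] at hx1
      simp only [Set.mem_ofPred_eq, Vw, Set.indicator_of_mem hx2]
      refine ENNReal.ofReal_le_ofReal ?_
      rw [hκ, div_le_iff₀ hpos]
      rw [Real.exp_sub, div_le_iff₀ (Real.exp_pos _)] at hx1
      linarith
    have hmk := mul_meas_ge_le_lintegral₀ (μ := μ) (hVm w).aemeasurable (ENNReal.ofReal κ)
    have h1 : ENNReal.ofReal κ * μ (S ∩ word f ξ n ⁻¹' {w}) ≤ 1 :=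
      (mul_le_mul_right (measure_mono hsub) _).trans
        (hmk.trans (Vw_lintegral_le hτ hfm hξm hm hf hξ hp n w))
    have h2 : κ * μ.real (S ∩ word f ξ n ⁻¹' {w}) ≤ 1 := by
      have := ENNReal.toReal_mono ENNReal.one_ne_top h1
      rw [ENNReal.toReal_mul, ENNReal.toReal_ofReal hκ0.le] at this
      simpa [Measure.real] using this
    rw [hκ, div_mul_eq_mul_div, div_le_one hpos] at h2
    rw [neg_mul, Real.exp_neg, inv_mul_eq_div, le_div_iff₀ (Real.exp_pos _)]
    linarith
  have hcover : S ⊆ ⋃ w ∈ (Finset.univ : Finset (Fin n → A)), S ∩ word f ξ n ⁻¹' {w} := by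
    intro x hx
    simp only [Set.mem_iUnion]
    exact ⟨word f ξ n x, Finset.mem_univ _, hx, rfl⟩
  have htot : ∑ w, μ.real (word f ξ n ⁻¹' {w}) = 1 := by
    have := integral_finite_comp (μ := μ) (word_measurable hfm.measurable hξm n) (fun _ => (1:ℝ))
    simp only [mul_one, integral_const, probReal_univ, smul_eq_mul] at this
    exact this.symm
  calc μ.real S ≤ _ := measureReal_mono hcover (measure_ne_top _ _)
    _ ≤ ∑ w, μ.real (S ∩ word f ξ n ⁻¹' {w}) := measureReal_biUnion_finset_le _ _
    _ ≤ ∑ w, Real.exp (-δ * n) * μ.real (word f ξ n ⁻¹' {w}) := Finset.sum_le_sum fun w _ => hw w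
    _ = Real.exp (-δ * n) := by rw [← Finset.mul_sum, htot, mul_one]

end Lower
end BK

namespace BK
set_option linter.unusedSectionVars false

section Lower2
variable {Ω : Type*} {m m0 : MeasurableSpace Ω} {A : Type*} [Fintype A] [MeasurableSpace A]
  [MeasurableSingletonClass A]

lemma log_max_bound {p τ : ℝ} (hp : p ∈ Set.Icc (0:ℝ) 1) (hτ : 0 < τ) (hτ1 : τ < 1) :
    0 ≤ -Real.log (max p τ) ∧ -Real.log (max p τ) ≤ -Real.log τ := by
  constructor
  · have := Real.log_nonpos (le_max_of_le_right hτ.le : 0 ≤ max p τ) (max_le hp.2 hτ1.le)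
    linarith
  · have := Real.log_le_log hτ (le_max_right p τ)
    linarith

lemma psi_integral {μ : Measure Ω} [IsProbabilityMeasure μ] {ξ : Ω → A}
    {p : A → Ω → ℝ} {τ : ℝ} (hτ : 0 < τ) (hτ1 : τ < 1) (hξm : Measurable ξ) (hm : m ≤ m0)
    (hp : ∀ a, p a = μ[(ξ ⁻¹' {a}).indicator (fun _ => (1:ℝ)) | m]) :
    Integrable (psi p ξ τ) μ ∧
      ∫ x, psi p ξ τ x ∂μ = ∑ a, ∫ x, -Real.log (max (p a x) τ) * p a x ∂μ := by
  classical
  have hpm : ∀ a, Measurable[m] (p a) := fun a => by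
    rw [hp a]; exact stronglyMeasurable_condExp.measurable
  have hpm0 : ∀ a, Measurable (p a) := fun a => (hpm a).mono hm le_rfl
  have hset : ∀ a, MeasurableSet (ξ ⁻¹' {a}) := fun a => hξm (measurableSet_singleton a)
  have hmem : ∀ a, ∀ᵐ x ∂μ, p a x ∈ Set.Icc (0:ℝ) 1 := fun a => by
    rw [hp a]; exact condExp_ind_mem (hset a) m hm
  have hb : ∀ a, ∀ᵐ x ∂μ, ‖-Real.log (max (p a x) τ)‖ ≤ -Real.log τ := fun a => by
    filter_upwards [hmem a] with x hx
    have := log_max_bound hx hτ hτ1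
    rw [Real.norm_eq_abs, abs_of_nonneg this.1]
    exact this.2
  have hLm : ∀ a, Measurable[m] (fun x => -Real.log (max (p a x) τ)) := fun a =>
    ((hpm a).max measurable_const).log.neg
  have hLi : ∀ a, Integrable (fun x => -Real.log (max (p a x) τ)) μ := fun a =>
    (integrable_const (-Real.log τ)).mono' ((hLm a).mono hm le_rfl).aestronglyMeasurable (hb a)
  have hdec : psi p ξ τ = fun x => ∑ a, (-Real.log (max (p a x) τ)) *
      (ξ ⁻¹' {a}).indicator (fun _ => (1:ℝ)) x := by
    ext x
    rw [Finset.sum_eq_single (ξ x)]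
    · simp [psi]
    · intro b _ hb
      have : x ∉ ξ ⁻¹' {b} := fun h => hb (by simpa using h.symm)
      simp [this]
    · simp
  have hi1 : ∀ a, Integrable ((ξ ⁻¹' {a}).indicator (fun _ => (1:ℝ))) μ := fun a =>
    (integrable_const (1:ℝ)).indicator (hset a)
  have hi : ∀ a, Integrable (fun x => (-Real.log (max (p a x) τ)) *
      (ξ ⁻¹' {a}).indicator (fun _ => (1:ℝ)) x) μ := fun a =>
    (hi1 a).bdd_mul ((hLm a).mono hm le_rfl).aestronglyMeasurable (hb a)
  refine ⟨?_, ?_⟩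
  · rw [hdec]; exact integrable_finsetSum _ fun a _ => hi a
  · rw [hdec, integral_finsetSum _ fun a _ => hi a]
    refine Finset.sum_congr rfl fun a _ => ?_
    have h := condExp_stronglyMeasurable_mul_of_bound hm (hLm a).stronglyMeasurable (hi1 a) _ (hb a)
    rw [← hp a] at h
    have h2 := integral_condExp (μ := μ) hm (f := (fun x => -Real.log (max (p a x) τ)) *
      (ξ ⁻¹' {a}).indicator (fun _ => (1:ℝ)))
    rw [integral_congr_ae h] at h2
    exact h2.symm

lemma psi_large {μ : Measure Ω} [IsProbabilityMeasure μ] {ξ : Ω → A}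
    {p : A → Ω → ℝ} (hξm : Measurable ξ) (hm : m ≤ m0)
    (hp : ∀ a, p a = μ[(ξ ⁻¹' {a}).indicator (fun _ => (1:ℝ)) | m]) {c : ℝ}
    (hc : c < ∑ a, ∫ x, Real.negMulLog (p a x) ∂μ) :
    ∃ τ, 0 < τ ∧ Integrable (psi p ξ τ) μ ∧ c < ∫ x, psi p ξ τ x ∂μ := by
  have hpm0 : ∀ a, Measurable (p a) := fun a => by
    rw [hp a]; exact (stronglyMeasurable_condExp.mono hm).measurable
  have hset : ∀ a, MeasurableSet (ξ ⁻¹' {a}) := fun a => hξm (measurableSet_singleton a)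
  have hmem : ∀ a, ∀ᵐ x ∂μ, p a x ∈ Set.Icc (0:ℝ) 1 := fun a => by
    rw [hp a]; exact condExp_ind_mem (hset a) m hm
  have hτ : ∀ k : ℕ, Real.exp (-((k:ℝ) + 1)) < 1 := fun k => by
    rw [Real.exp_lt_one_iff]; have : (0:ℝ) ≤ k := k.cast_nonneg; linarith
  have hτlim : Tendsto (fun k : ℕ => Real.exp (-((k:ℝ) + 1))) atTop (nhds 0) := by
    refine Real.tendsto_exp_neg_atTop_nhds_zero.comp ?_
    exact tendsto_atTop_add_const_right _ _ tendsto_natCast_atTop_atTop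
  have hlim : Tendsto (fun k : ℕ => ∫ x, psi p ξ (Real.exp (-((k:ℝ) + 1))) x ∂μ) atTop
      (nhds (∑ a, ∫ x, Real.negMulLog (p a x) ∂μ)) := by
    simp_rw [fun k => (psi_integral (Real.exp_pos _) (hτ k) hξm hm hp).2]
    refine tendsto_finsetSum _ fun a _ => ?_
    refine tendsto_integral_of_dominated_convergence (fun _ => (1:ℝ)) ?_ (integrable_const _) ?_ ?_
    · intro k
      exact ((((hpm0 a).max measurable_const).log.neg).mul (hpm0 a)).aestronglyMeasurable
    · intro k
      filter_upwards [hmem a] with x hx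
      have h1 := log_max_bound hx (Real.exp_pos _) (hτ k)
      rw [Real.norm_eq_abs, abs_of_nonneg (mul_nonneg h1.1 hx.1)]
      rcases eq_or_lt_of_le hx.1 with h0 | h0
      · rw [← h0]; simp
      · have h2 : -Real.log (max (p a x) (Real.exp (-((k:ℝ) + 1)))) ≤ -Real.log (p a x) :=
          neg_le_neg (Real.log_le_log h0 (le_max_left _ _))
        have h3 := negMulLog_abs_le hx
        have h4 := (le_abs_self _).trans h3
        rw [Real.negMulLog] at h4
        nlinarith
    · filter_upwards [hmem a] with x hx
      rcases eq_or_lt_of_le hx.1 with h0 | h0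
      · rw [← h0]; simp
      · refine tendsto_const_nhds.congr' ?_
        filter_upwards [hτlim.eventually_lt_const h0] with k hk
        rw [max_eq_left hk.le, Real.negMulLog]; ring
  obtain ⟨k, hk⟩ := (hlim.eventually_const_lt hc).exists
  exact ⟨_, Real.exp_pos _, (psi_integral (Real.exp_pos _) (hτ k) hξm hm hp).1, hk⟩
end Lower2

section Lower3
variable {Ω : Type*} [m0 : MeasurableSpace Ω] {A : Type*} [Fintype A] [MeasurableSpace A]
  [MeasurableSingletonClass A]

lemma fut_le {f : Ω → Ω} {ξ : Ω → A} (hf : Measurable f) (hξ : Measurable ξ) :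
    (⨆ n, futFil hf hξ n) ≤ m0 := iSup_le fun n => (futFil hf hξ).le n

lemma fut_meas {f : Ω → Ω} {ξ : Ω → A} (hf : Measurable f) (hξ : Measurable ξ) :
    Measurable[⨆ n, futFil hf hξ n, ⨆ n, futFil hf hξ n] f := by
  rw [measurable_iff_comap_le, MeasurableSpace.comap_iSup]
  refine iSup_le fun n => le_trans ?_ (le_iSup _ (n + 1))
  change MeasurableSpace.comap f (MeasurableSpace.comap (fun x => word f ξ n (f x)) inferInstance) ≤
    MeasurableSpace.comap (fun x => word f ξ (n + 1) (f x)) inferInstance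
  rw [MeasurableSpace.comap_comp]
  have : (fun x => word f ξ n (f x)) ∘ f = (fun w : Fin (n + 1) → A => fun j : Fin n => w j.succ)
      ∘ (fun x => word f ξ (n + 1) (f x)) := rfl
  rw [this, ← MeasurableSpace.comap_comp]
  refine MeasurableSpace.comap_mono ?_
  rw [← measurable_iff_comap_le]
  exact measurable_pi_lambda _ fun j => measurable_pi_apply _

lemma fut_xi {f : Ω → Ω} {ξ : Ω → A} (hf : Measurable f) (hξ : Measurable ξ) :
    Measurable[⨆ n, futFil hf hξ n] (fun x => ξ (f x)) := by
  rw [measurable_iff_comap_le]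
  refine le_trans ?_ (le_iSup _ 1)
  change _ ≤ MeasurableSpace.comap (fun x => word f ξ 1 (f x)) inferInstance
  have : (fun x => ξ (f x)) = (fun w : Fin 1 → A => w 0) ∘ (fun x => word f ξ 1 (f x)) := rfl
  rw [this, ← MeasurableSpace.comap_comp]
  refine MeasurableSpace.comap_mono ?_
  rw [← measurable_iff_comap_le]
  exact measurable_pi_apply _

lemma lower_smb {μ : Measure Ω} [IsProbabilityMeasure μ] {f g : Ω → Ω} {ξ : Ω → A}
    (hf : Ergodic f μ) (hg : Ergodic g μ) (hfg : ∀ x, f (g x) = x) (hξ : Measurable ξ) {c : ℝ}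
    (hc : c < ∑ a, ∫ x, Real.negMulLog (pinf μ hf.measurable hξ a x) ∂μ) :
    ∀ᵐ x ∂μ, ∀ᶠ n : ℕ in atTop,
      cm μ f ξ (2 * n + 1) (g^[n] x) ≤ Real.exp (-c * (2 * n + 1 : ℕ)) := by
  obtain ⟨c', hcc, hc'⟩ := exists_between hc
  have hp : ∀ a, pinf μ hf.measurable hξ a = μ[(ξ ⁻¹' {a}).indicator (fun _ => (1:ℝ)) |
    ⨆ n, futFil hf.measurable hξ n] := fun a => rfl
  have hle := fut_le hf.measurable hξ
  obtain ⟨τ, hτ, hInt, hlt⟩ := psi_large hξ hle hp hc'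
  have hpm0 : ∀ a, Measurable (pinf μ hf.measurable hξ a) := fun a => by
    rw [hp a]; exact (stronglyMeasurable_condExp.mono hle).measurable
  set ψ := psi (pinf μ hf.measurable hξ) ξ τ with hψ
  have hψm : Measurable ψ := psi_measurable hpm0 hξ τ
  have h1 := birkhoff_two_le hf hg hfg (φ := fun x => -ψ x) hψm.neg hInt.neg (c := -c')
    (by rw [integral_neg]; linarith)
  set δ := (c' - c) / 2 with hδ
  have hδ0 : 0 < δ := by rw [hδ]; linarith
  have h2 := borelCantelli_moving (μ := μ) (θ := fun n => g^[n])
    (s := fun n => {x | Real.exp (δ * (2 * n + 1 : ℕ) - birkhoffSum f ψ (2 * n + 1) x) ≤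
      cm μ f ξ (2 * n + 1) x}) (fun n => hg.toMeasurePreserving.iterate n) (C := 1) hδ0 (by
      intro n
      refine (lower_block hτ hf.toMeasurePreserving hξ hle (fut_meas _ _) (fut_xi _ _) hp
        (2 * n + 1) δ).trans ?_
      rw [one_mul, Real.exp_le_exp]
      push_cast
      have : (0:ℝ) ≤ n := n.cast_nonneg
      nlinarith)
  filter_upwards [h1, h2] with x ⟨B, hB⟩ hx2
  have hlarge : ∀ᶠ n : ℕ in atTop, B ≤ δ * n :=
    (tendsto_natCast_atTop_atTop.const_mul_atTop hδ0).eventually_ge_atTop B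
  filter_upwards [hx2, hlarge] with n hn hn2
  simp only [Set.mem_ofPred_eq, not_le] at hn
  refine hn.le.trans ?_
  rw [Real.exp_le_exp]
  have hb := hB n (n + 1)
  have e : n + (n + 1) = 2 * n + 1 := by ring
  rw [e] at hb
  have e2 : birkhoffSum f (fun x => -ψ x) (2 * n + 1) (g^[n] x)
      = - birkhoffSum f ψ (2 * n + 1) (g^[n] x) := by
    simp [birkhoffSum]
  rw [e2] at hb
  push_cast at hb ⊢
  have : (0:ℝ) ≤ n := n.cast_nonneg
  have e3 : c' = c + 2 * δ := by rw [hδ]; ring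
  rw [e3] at hb
  nlinarith
end Lower3
end BK

namespace BK
set_option linter.unusedSectionVars false

section Hamming
variable {A : Type*} [Fintype A]

open Classical in
lemma hamming_count (N : ℕ) (w0 : Fin N → A) (lam r : ℝ) (hlam : 0 ≤ lam) :
    ((Finset.univ.filter fun w : Fin N → A =>
      ((Finset.univ.filter fun j => w j ≠ w0 j).card : ℝ) ≤ r).card : ℝ)
      ≤ Real.exp (lam * r + N * (Fintype.card A * Real.exp (-lam))) := by
  set F : Fin N → A → ℝ := fun j a => if a ≠ w0 j then Real.exp (-lam) else 1 with hF
  have h1 : ∀ w : Fin N → A, ∏ j, F j (w j) =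
      Real.exp (-lam * ((Finset.univ.filter fun j => w j ≠ w0 j).card : ℝ)) := by
    intro w
    simp only [hF]
    rw [Finset.prod_ite, Finset.prod_const, Finset.prod_const_one, mul_one, ← Real.exp_nat_mul]
    congr 1; ring
  have h2 : ∑ w : Fin N → A, ∏ j, F j (w j) = ∏ j, ∑ a, F j a := by
    rw [Finset.prod_univ_sum]; simp
  have h3 : ∏ j, ∑ a, F j a ≤ Real.exp (N * (Fintype.card A * Real.exp (-lam))) := by
    have h4 : ∀ j, ∑ a, F j a ≤ Real.exp (Fintype.card A * Real.exp (-lam)) := by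
      intro j
      have : ∑ a, F j a ≤ ∑ a, (Real.exp (-lam) + if a = w0 j then 1 else 0) := by
        refine Finset.sum_le_sum fun a _ => ?_
        simp only [hF]
        by_cases h : a = w0 j
        · simp [h, (Real.exp_pos _).le]
        · simp [h]
      refine this.trans ?_
      rw [Finset.sum_add_distrib]
      simp only [Finset.sum_const, Finset.card_univ, nsmul_eq_mul, Finset.sum_ite_eq',
        Finset.mem_univ, if_true]
      exact Real.add_one_le_exp _
    refine (Finset.prod_le_prod (fun j _ => Finset.sum_nonneg fun a _ => ?_)
      fun j _ => h4 j).trans ?_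
    · simp only [hF]; split_ifs <;> positivity
    · rw [Finset.prod_const, ← Real.exp_nat_mul]; simp
  have h5 : ((Finset.univ.filter fun w : Fin N → A =>
      ((Finset.univ.filter fun j => w j ≠ w0 j).card : ℝ) ≤ r).card : ℝ) * Real.exp (-lam * r) ≤
      ∑ w : Fin N → A, ∏ j, F j (w j) := by
    rw [← nsmul_eq_mul]
    calc _ ≤ ∑ w ∈ (Finset.univ.filter fun w : Fin N → A =>
          ((Finset.univ.filter fun j => w j ≠ w0 j).card : ℝ) ≤ r), ∏ j, F j (w j) := by
          refine Finset.card_nsmul_le_sum _ _ _ fun w hw => ?_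
          rw [h1, Real.exp_le_exp]
          have := (Finset.mem_filter.1 hw).2
          nlinarith
      _ ≤ _ := Finset.sum_le_univ_sum_of_nonneg fun w => by
          rw [h1]; exact (Real.exp_pos _).le
  rw [h2] at h5
  have h6 := h5.trans h3
  rw [Real.exp_add]
  have h7 : Real.exp (-lam * r) * Real.exp (lam * r) = 1 := by
    rw [← Real.exp_add]; simp
  have := mul_le_mul_of_nonneg_left h6 (Real.exp_pos (lam * r)).le
  nlinarith
end Hamming

section Packing
variable {T : Type*} [MetricSpace T] [MeasurableSpace T] [BorelSpace T]

/-- Bowen ball of length `N`. -/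
def bball (f : T → T) (N : ℕ) (y : T) (ε : ℝ) : Set T :=
  {s | ∀ j < N, dist (f^[j] y) (f^[j] s) < ε}

lemma bball_open {f : T → T} (hf : Continuous f) (N : ℕ) (y : T) (ε : ℝ) :
    IsOpen (bball f N y ε) := by
  have : bball f N y ε = ⋂ j ∈ Finset.range N, {s | dist (f^[j] y) (f^[j] s) < ε} := by
    ext s; simp [bball]
  rw [this]
  refine isOpen_biInter_finset fun j _ => ?_
  exact isOpen_lt (continuous_const.dist (hf.iterate j)) continuous_const

lemma packing {μ : Measure T} [IsProbabilityMeasure μ] {f : T → T} (hf : Continuous f) {N : ℕ}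
    {ε r q : ℝ} (hε : 0 < ε) (hr : 0 < r) (hq : 0 ≤ q) {D : Set T}
    (h1 : ∀ y ∈ D, r ≤ μ.real (bball f N y ε))
    (h2 : ∀ y ∈ D, μ.real (D ∩ bball f N y (2 * ε)) ≤ q) : μ.real D ≤ q / r := by
  classical
  let Q : Finset T → Prop := fun F => (F : Set T) ⊆ D ∧
    (F : Set T).PairwiseDisjoint (fun y => bball f N y ε)
  have hcard : ∀ F, Q F → (F.card : ℝ) ≤ 1 / r := by
    rintro F ⟨hFD, hFd⟩
    rw [le_div_iff₀ hr]
    have h3 : ∑ y ∈ F, μ.real (bball f N y ε) = μ.real (⋃ y ∈ F, bball f N y ε) :=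
      (measureReal_biUnion_finset hFd fun y _ => (bball_open hf N y ε).measurableSet).symm
    have h4 : (F.card : ℝ) * r ≤ ∑ y ∈ F, μ.real (bball f N y ε) := by
      rw [← nsmul_eq_mul]
      exact Finset.card_nsmul_le_sum _ _ _ fun y hy => h1 y (hFD hy)
    rw [h3] at h4
    exact h4.trans measureReal_le_one
  obtain ⟨F, hF, hmax⟩ : ∃ F, Q F ∧ ∀ F', Q F' → F'.card ≤ F.card := by
    have hex : ∃ n, ∃ F, Q F ∧ F.card = n := ⟨0, ∅, ⟨by simp, by simp⟩, rfl⟩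
    have hb : ∀ n, (∃ F, Q F ∧ F.card = n) → n ≤ ⌊1 / r⌋₊ := by
      rintro n ⟨F, hF, rfl⟩
      exact Nat.le_floor (hcard F hF)
    obtain ⟨n0, hn0⟩ := hex
    obtain ⟨F, hF, hFc⟩ := Nat.findGreatest_spec (P := fun n => ∃ F, Q F ∧ F.card = n)
      (hb n0 hn0) hn0
    refine ⟨F, hF, fun F' hF' => ?_⟩
    rw [hFc]
    exact Nat.le_findGreatest (hb _ ⟨F', hF', rfl⟩) ⟨F', hF', rfl⟩
  have hcov : D ⊆ ⋃ y ∈ F, D ∩ bball f N y (2 * ε) := by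
    intro z hz
    simp only [Set.mem_iUnion]
    by_contra hcon
    push Not at hcon
    have hzF : z ∉ F := fun h => hcon z h ⟨hz, fun j _ => by simp [hε]⟩
    have hQ : Q (insert z F) := by
      refine ⟨?_, ?_⟩
      · rw [Finset.coe_insert]; exact Set.insert_subset hz hF.1
      · rw [Finset.coe_insert]
        refine hF.2.insert fun y hy _ => ?_
        rw [Set.disjoint_left]
        intro s hs1 hs2
        refine hcon y hy ⟨hz, fun j hj => ?_⟩
        have a := hs1 j hj
        have b := hs2 j hj
        have := dist_triangle_right (f^[j] y) (f^[j] z) (f^[j] s)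
        linarith
    have := hmax _ hQ
    rw [Finset.card_insert_of_notMem hzF] at this
    omega
  calc μ.real D ≤ _ := measureReal_mono hcov (measure_ne_top _ _)
    _ ≤ ∑ y ∈ F, μ.real (D ∩ bball f N y (2 * ε)) := measureReal_biUnion_finset_le _ _
    _ ≤ ∑ y ∈ F, q := Finset.sum_le_sum fun y hy => h2 y (hF.1 hy)
    _ = F.card * q := by simp
    _ ≤ 1 / r * q := mul_le_mul_of_nonneg_right (hcard F hF) hq
    _ = q / r := by ring
end Packing

section BKLower
variable {T : Type*} [MetricSpace T] [CompactSpace T] [MeasurableSpace T] [BorelSpace T]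
  {A : Type*} [Fintype A] [MeasurableSpace A] [MeasurableSingletonClass A]

lemma exists_bad {μ : Measure T} [IsProbabilityMeasure μ] {ξ : T → A} (hξ : Measurable ξ) {θ : ℝ}
    (hθ : 0 < θ) : ∃ Bad : Set T, MeasurableSet Bad ∧ μ.real Bad < θ ∧ ∃ ε > 0, ∀ x y,
      x ∉ Bad → y ∉ Bad → dist x y < ε → ξ x = ξ y := by
  classical
  have hK : ∀ a : A, ∃ K ⊆ ξ ⁻¹' {a}, IsCompact K ∧
      μ (ξ ⁻¹' {a} \ K) < ENNReal.ofReal (θ / (Fintype.card A + 1)) := fun a =>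
    (hξ (measurableSet_singleton a)).exists_isCompact_sdiff_lt (measure_ne_top _ _)
      (by simp only [ne_eq, ENNReal.ofReal_eq_zero, not_le]; positivity)
  choose K hKs hKc hKm using hK
  have hBm : ∀ a, MeasurableSet (ξ ⁻¹' {a} \ K a) := fun a =>
    (hξ (measurableSet_singleton a)).diff (hKc a).measurableSet
  refine ⟨⋃ a ∈ (Finset.univ : Finset A), (ξ ⁻¹' {a} \ K a),
    Finset.measurableSet_biUnion _ fun a _ => hBm a, ?_, ?_⟩
  · calc _ ≤ ∑ a, μ.real (ξ ⁻¹' {a} \ K a) := measureReal_biUnion_finset_le _ _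
      _ ≤ ∑ a : A, θ / (Fintype.card A + 1) := by
        refine Finset.sum_le_sum fun a _ => ?_
        exact ENNReal.toReal_le_of_le_ofReal (by positivity) (hKm a).le
      _ = (Fintype.card A : ℝ) / (Fintype.card A + 1) * θ := by simp; ring
      _ < 1 * θ := by
        refine mul_lt_mul_of_pos_right ?_ hθ
        rw [div_lt_one (by positivity)]
        linarith
      _ = θ := one_mul _
  · have hev : ∀ a b : A, ∀ᶠ ε in nhdsWithin (0:ℝ) (Set.Ioi 0),
        a ≠ b → ∀ x ∈ K a, ∀ y ∈ K b, ε ≤ dist x y := by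
      intro a b
      by_cases hab : a = b
      · exact Eventually.of_forall fun _ h => absurd hab h
      have hd : Disjoint (K a) (K b) := by
        rw [Set.disjoint_left]
        intro x hx hy
        exact hab ((hKs a hx : ξ x = a).symm.trans (hKs b hy))
      obtain ⟨δ, hδ, hδd⟩ := hd.exists_thickenings (hKc a) (hKc b).isClosed
      filter_upwards [Ioo_mem_nhdsGT hδ] with ε hε _ x hx y hy
      by_contra hlt
      push Not at hlt
      refine (Set.disjoint_left.1 hδd) (Metric.self_subset_thickening hδ _ hx) ?_
      rw [Metric.mem_thickening_iff]
      exact ⟨y, hy, hlt.trans hε.2⟩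
    have hall : ∀ᶠ ε in nhdsWithin (0:ℝ) (Set.Ioi 0), ∀ a b : A,
        a ≠ b → ∀ x ∈ K a, ∀ y ∈ K b, ε ≤ dist x y :=
      eventually_all.2 fun a => eventually_all.2 fun b => hev a b
    obtain ⟨ε, hε, hε0⟩ := (hall.and self_mem_nhdsWithin).exists
    refine ⟨ε, hε0, fun x y hx hy hxy => ?_⟩
    simp only [Set.mem_iUnion, Finset.mem_univ, exists_prop, true_and, not_exists, Set.mem_sdiff,
      Set.mem_preimage, Set.mem_singleton_iff, not_and, not_not] at hx hy
    by_contra hne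
    exact absurd (hε _ _ hne x (hx _ rfl) y (hy _ rfl)) (not_le.2 hxy)

lemma ball_G {μ : Measure T} [IsProbabilityMeasure μ] {f : T → T} {ξ : T → A}
    {Bad : Set T} {ε : ℝ}
    (hbad : ∀ x y, x ∉ Bad → y ∉ Bad → dist x y < ε → ξ x = ξ y) {N : ℕ} {θ c lam : ℝ}
    (hlam : 0 ≤ lam) {G : Set T}
    (hG1 : ∀ y ∈ G, cm μ f ξ N y ≤ Real.exp (-c * N))
    (hG2 : ∀ y ∈ G, birkhoffSum f (Bad.indicator fun _ => (1:ℝ)) N y ≤ θ * N) {y : T} (hy : y ∈ G) :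
    μ.real (G ∩ bball f N y ε) ≤
      Real.exp (lam * (2 * θ * N) + N * (Fintype.card A * Real.exp (-lam)) - c * N) := by
  classical
  set W := Finset.univ.filter fun w : Fin N → A =>
      ((Finset.univ.filter fun j => w j ≠ word f ξ N y j).card : ℝ) ≤ 2 * θ * N with hW
  have hbs : ∀ z, birkhoffSum f (Bad.indicator fun _ => (1:ℝ)) N z =
      ∑ j : Fin N, Bad.indicator (fun _ => (1:ℝ)) (f^[j] z) := by
    intro z; rw [birkhoffSum, Finset.sum_range]
  have hcov : G ∩ bball f N y ε ⊆ ⋃ w ∈ W, G ∩ word f ξ N ⁻¹' {w} := by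
    rintro z ⟨hz, hzb⟩
    simp only [Set.mem_iUnion]
    refine ⟨word f ξ N z, ?_, hz, rfl⟩
    rw [hW, Finset.mem_filter]
    refine ⟨Finset.mem_univ _, ?_⟩
    have h1 : ((Finset.univ.filter fun j => word f ξ N z j ≠ word f ξ N y j).card : ℝ) ≤
        ∑ j : Fin N, (Bad.indicator (fun _ => (1:ℝ)) (f^[j] z) +
          Bad.indicator (fun _ => (1:ℝ)) (f^[j] y)) := by
      rw [Finset.card_filter]
      push_cast
      refine Finset.sum_le_sum fun j _ => ?_
      have n1 : 0 ≤ Bad.indicator (fun _ => (1:ℝ)) (f^[j] z) :=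
        Set.indicator_nonneg (fun _ _ => zero_le_one) _
      have n2 : 0 ≤ Bad.indicator (fun _ => (1:ℝ)) (f^[j] y) :=
        Set.indicator_nonneg (fun _ _ => zero_le_one) _
      split_ifs with hne
      · by_cases hbz : f^[j] z ∈ Bad
        · rw [Set.indicator_of_mem hbz]; linarith
        · by_cases hby : f^[j] y ∈ Bad
          · rw [Set.indicator_of_mem hby]; linarith
          · exact absurd (hbad _ _ hby hbz (hzb j j.2)).symm hne
      · linarith
    rw [Finset.sum_add_distrib, ← hbs, ← hbs] at h1
    linarith [hG2 z hz, hG2 y hy]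
  have hcell : ∀ w : Fin N → A, μ.real (G ∩ word f ξ N ⁻¹' {w}) ≤ Real.exp (-c * N) := by
    intro w
    rcases Set.eq_empty_or_nonempty (G ∩ word f ξ N ⁻¹' {w}) with h | ⟨z, hz, hzw⟩
    · rw [h]; simp [(Real.exp_pos _).le]
    · have h1 := hG1 z hz
      have h2 : word f ξ N z = w := hzw
      rw [cm, h2] at h1
      exact (measureReal_mono Set.inter_subset_right (measure_ne_top _ _)).trans h1
  calc μ.real (G ∩ bball f N y ε) ≤ _ := measureReal_mono hcov (measure_ne_top _ _)
    _ ≤ ∑ w ∈ W, μ.real (G ∩ word f ξ N ⁻¹' {w}) := measureReal_biUnion_finset_le _ _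
    _ ≤ ∑ w ∈ W, Real.exp (-c * N) := Finset.sum_le_sum fun w _ => hcell w
    _ = W.card * Real.exp (-c * N) := by simp
    _ ≤ _ * Real.exp (-c * N) := mul_le_mul_of_nonneg_right
        (hamming_count N (word f ξ N y) lam (2 * θ * N) hlam) (Real.exp_pos _).le
    _ = _ := by rw [← Real.exp_add]; congr 1; ring

lemma bk_lower {μ : Measure T} [IsProbabilityMeasure μ] {f g : T → T} {ξ : T → A}
    (hfc : Continuous f)
    (hf : Ergodic f μ) (hg : Ergodic g μ) (hfg : ∀ x, f (g x) = x) (hξ : Measurable ξ) {c : ℝ}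
    (hc : c < ∑ a, ∫ x, Real.negMulLog (pinf μ hf.measurable hξ a x) ∂μ) :
    ∃ ε > 0, ∀ᵐ x ∂μ, ∀ᶠ n : ℕ in atTop,
      μ.real (bball f (2 * n + 1) (g^[n] x) ε) ≤ Real.exp (-c * (2 * n + 1 : ℕ)) := by
  obtain ⟨c1, hcc, hc1⟩ := exists_between hc
  set γ := c1 - c with hγ
  have hγ0 : 0 < γ := by rw [hγ]; linarith
  obtain ⟨lam, hlam0, hlam⟩ : ∃ lam : ℝ, 0 < lam ∧ Fintype.card A * Real.exp (-lam) < γ / 4 := by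
    have : Tendsto (fun l : ℝ => Fintype.card A * Real.exp (-l)) atTop (nhds (Fintype.card A * 0)) :=
      Real.tendsto_exp_neg_atTop_nhds_zero.const_mul _
    rw [mul_zero] at this
    exact ((eventually_gt_atTop 0).and
      (this.eventually_lt_const (by positivity : (0:ℝ) < γ / 4))).exists
  set θ := γ / (8 * lam) with hθ
  have hθ0 : 0 < θ := by positivity
  have hθl : lam * (2 * θ) = γ / 4 := by rw [hθ]; field_simp; ring
  obtain ⟨Bad, hBm, hBμ, ε0, hε0, hbad⟩ := exists_bad (μ := μ) hξ (half_pos hθ0)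
  refine ⟨ε0 / 2, by positivity, ?_⟩
  set φ : T → ℝ := Bad.indicator fun _ => (1:ℝ) with hφ
  have hφi : Integrable φ μ := (integrable_const (1:ℝ)).indicator hBm
  have hφm : Measurable φ := measurable_const.indicator hBm
  have h1 := birkhoff_two_le hf hg hfg hφm hφi (c := θ / 2) (by
    rw [hφ, integral_indicator_const _ hBm]; simpa using hBμ)
  have h2 := lower_smb hf hg hfg hξ hc1
  set G : ℕ → Set T := fun N => {y | cm μ f ξ N y ≤ Real.exp (-c1 * N) ∧
    birkhoffSum f φ N y ≤ θ * N} with hG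
  set D : ℕ → Set T := fun N => {y | y ∈ G N ∧
    Real.exp (-c * N) ≤ μ.real (bball f N y (ε0 / 2))} with hD
  have hDμ : ∀ N, μ.real (D N) ≤ Real.exp (-(γ / 2) * N) := by
    intro N
    have hp := packing (μ := μ) hfc (N := N) (ε := ε0 / 2) (r := Real.exp (-c * N))
      (q := Real.exp (lam * (2 * θ * N) + N * (Fintype.card A * Real.exp (-lam)) - c1 * N))
      (by positivity) (Real.exp_pos _) (Real.exp_pos _).le (D := D N) (fun y hy => hy.2) (by
        intro y hy
        rw [mul_div_cancel₀ _ (two_ne_zero)]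
        refine (measureReal_mono (Set.inter_subset_inter_left _ ?_) (measure_ne_top _ _)).trans
          (ball_G hbad hlam0.le (G := G N) (fun y hy => hy.1) (fun y hy => hy.2)
            hy.1)
        exact fun z hz => hz.1)
    refine hp.trans ?_
    rw [← Real.exp_sub, Real.exp_le_exp]
    have hN : (0:ℝ) ≤ N := N.cast_nonneg
    have e1 : c1 = c + γ := by rw [hγ]; ring
    have e2 : lam * (2 * θ * N) = γ / 4 * N := by rw [← hθl]; ring
    rw [e1, e2]
    nlinarith
  have h3 := borelCantelli_moving (μ := μ) (θ := fun n => g^[n]) (s := fun n => D (2 * n + 1))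
    (fun n => hg.toMeasurePreserving.iterate n) (C := 1) (half_pos hγ0) (by
      intro n
      refine (hDμ _).trans ?_
      rw [one_mul, Real.exp_le_exp]
      push_cast
      have : (0:ℝ) ≤ n := n.cast_nonneg
      nlinarith)
  filter_upwards [h1, h2, h3] with x ⟨B, hB⟩ hx2 hx3
  have hlarge : ∀ᶠ n : ℕ in atTop, B ≤ θ / 2 * n :=
    (tendsto_natCast_atTop_atTop.const_mul_atTop (half_pos hθ0)).eventually_ge_atTop B
  filter_upwards [hx2, hx3, hlarge] with n hn2 hn3 hn4
  by_contra hcon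
  push Not at hcon
  refine hn3 ⟨⟨hn2, ?_⟩, hcon.le⟩
  have hb := hB n (n + 1)
  have e : n + (n + 1) = 2 * n + 1 := by ring
  rw [e] at hb
  refine hb.trans ?_
  push_cast
  have : (0:ℝ) ≤ n := n.cast_nonneg
  nlinarith
end BKLower
end BK

namespace BK
set_option linter.unusedSectionVars false

section Bridge

/-- The finite alphabet of a partition. -/
def PA {X : Type*} [MeasurableSpace X] (P : FinMeasPartition X) : Type _ := Set.range P.part

noncomputable instance instPAFintype {X : Type*} [MeasurableSpace X] (P : FinMeasPartition X) :
    Fintype (PA P) := P.finite_range.fintype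

instance instPAMeas {X : Type*} [MeasurableSpace X] (P : FinMeasPartition X) :
    MeasurableSpace (PA P) := ⊤

instance instPASingle {X : Type*} [MeasurableSpace X] (P : FinMeasPartition X) :
    MeasurableSingletonClass (PA P) := ⟨fun _ => MeasurableSpace.measurableSet_top⟩

/-- The coding map of a partition. -/
def xi {X : Type*} [MeasurableSpace X] (P : FinMeasPartition X) (x : X) : PA P :=
  ⟨P.part x, x, rfl⟩

lemma xi_eq_iff {X : Type*} [MeasurableSpace X] (P : FinMeasPartition X) (x y : X) :
    xi P y = xi P x ↔ y ∈ P.part x := by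
  constructor
  · intro h
    have h1 : P.part y = P.part x := congrArg Subtype.val h
    rw [← h1]; exact P.mem_part y
  · intro h
    exact Subtype.ext (P.part_eq x y h)

lemma xi_measurable {X : Type*} [MeasurableSpace X] (P : FinMeasPartition X) :
    Measurable (xi P) := by
  have : Countable (PA P) := Finite.to_countable
  refine measurable_to_countable' ?_
  rintro ⟨_, x, rfl⟩
  have : xi P ⁻¹' {⟨P.part x, x, rfl⟩} = P.part x := by
    ext y
    exact xi_eq_iff P x y
  rw [this]
  exact P.measSet x

lemma cell_eq (f : Equiv.Perm T) (P : FinMeasPartition T) (n : ℕ) (x : T) :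
    oneSidedCell f P n x = word f (xi P) n ⁻¹' {word f (xi P) n x} := by
  ext y
  simp only [oneSidedCell, Set.mem_preimage, Set.mem_singleton_iff, funext_iff, word, xi_eq_iff,
    Equiv.Perm.iterate_eq_pow]
  exact ⟨fun h j => h j j.2, fun h i hi => h ⟨i, hi⟩⟩

lemma pe_tendsto (f : Equiv.Perm T) (ν : Measure T) [IsProbabilityMeasure ν]
    (hf : MeasurePreserving f ν ν) (P : FinMeasPartition T) :
    partitionEntropy f ν P = ∑ a, ∫ x, Real.negMulLog (pinf ν hf.measurable (xi_measurable P) a x) ∂ν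
    ∧ Tendsto (fun n : ℕ => (∫ x, info ν f (xi P) n x ∂ν) / n) atTop
      (nhds (partitionEntropy f ν P)) := by
  have h := entropy_tendsto hf (xi_measurable P)
  have e : partitionEntropy f ν P =
      ∑ a, ∫ x, Real.negMulLog (pinf ν hf.measurable (xi_measurable P) a x) ∂ν := by
    rw [← h.liminf_eq, partitionEntropy]
    simp_rw [cell_eq]
    rfl
  exact ⟨e, e ▸ h⟩

lemma iter_zpow (f : Equiv.Perm T) (j n : ℕ) (t : T) :
    (⇑f)^[j] ((⇑f.symm)^[n] t) = (f ^ ((j : ℤ) - n)) t := by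
  have : (f ^ ((j : ℤ) - n)) = f ^ j * (f⁻¹) ^ n := by
    rw [zpow_sub, zpow_natCast, zpow_natCast, inv_pow]
  rw [this, Equiv.Perm.mul_apply, ← Equiv.Perm.iterate_eq_pow, ← Equiv.Perm.iterate_eq_pow]
  rfl

lemma ball_pre (f : Equiv.Perm T) (n : ℕ) (t : T) (ε : ℝ) :
    twoSidedBall f n t ε = (⇑f.symm)^[n] ⁻¹' bball f (2 * n + 1) ((⇑f.symm)^[n] t) ε := by
  ext s
  simp only [twoSidedBall, bball, Set.mem_preimage, iter_zpow, Set.mem_ofPred_eq]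
  constructor
  · intro h j hj
    exact h _ (by rw [abs_le]; omega)
  · intro h i hi
    rw [abs_le] at hi
    have := h (i + n).toNat (by omega)
    have e : (((i + n).toNat : ℕ) : ℤ) - n = i := by omega
    rw [e] at this
    exact this

lemma ergodic_symm (f : Equiv.Perm T) (hf : Continuous f) (hf' : Continuous f.symm)
    (ν : Measure T) (herg : Ergodic (⇑f) ν) : Ergodic (⇑f.symm) ν := by
  let e : T ≃ᵐ T := ⟨f, hf.measurable, hf'.measurable⟩
  have : Ergodic e ν := herg
  exact this.symm

lemma ball_measure (f : Equiv.Perm T) (hf : Continuous f)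
    (ν : Measure T) (hg : Ergodic (⇑f.symm) ν) (n : ℕ) (t : T) (ε : ℝ) :
    (ν (twoSidedBall f n t ε)).toReal =
      ν.real (bball f (2 * n + 1) ((⇑f.symm)^[n] t) ε) := by
  rw [ball_pre, (hg.toMeasurePreserving.iterate n).measure_preimage
    (bball_open hf _ _ _).measurableSet.nullMeasurableSet]
  rfl

lemma ball_mono (f : Equiv.Perm T) (n : ℕ) (t : T) {ε ε' : ℝ} (h : ε ≤ ε') :
    twoSidedBall f n t ε ⊆ twoSidedBall f n t ε' := fun _ hs i hi => (hs i hi).trans_le h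

lemma ball_pos (f : Equiv.Perm T) (hf : Continuous f) (hf' : Continuous f.symm)
    (ν : Measure T) [IsProbabilityMeasure ν] :
    ∀ᵐ t ∂ν, ∀ n : ℕ, ∀ ε : ℝ, 0 < ε → 0 < (ν (twoSidedBall f n t ε)).toReal := by
  have h : ν.support ∈ ae ν := Measure.support_mem_ae
  filter_upwards [h] with t ht n ε hε
  have ho : IsOpen (twoSidedBall f n t ε) := by
    rw [ball_pre]
    exact (bball_open hf _ _ _).preimage (hf'.iterate n)
  have hm : t ∈ twoSidedBall f n t ε := fun i _ => by simp [hε]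
  rw [Measure.mem_support_iff_forall] at ht
  exact ENNReal.toReal_pos (ht _ (ho.mem_nhds hm)).ne' (measure_ne_top _ _)

lemma final_lower (f : Equiv.Perm T) (hf : Continuous f) (hf' : Continuous f.symm)
    (ν : Measure T) [IsProbabilityMeasure ν] (herg : Ergodic (⇑f) ν) (P : FinMeasPartition T) {c : ℝ}
    (hc : c < partitionEntropy f ν P) : ∃ ε > 0, ∀ᵐ t ∂ν, ∀ᶠ n : ℕ in atTop,
      (ν (twoSidedBall f n t ε)).toReal ≤ Real.exp (-c * (2 * n + 1 : ℕ)) := by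
  have hg := ergodic_symm f hf hf' ν herg
  rw [(pe_tendsto f ν herg.toMeasurePreserving P).1] at hc
  obtain ⟨ε, hε, h⟩ := bk_lower hf herg hg (fun x => f.apply_symm_apply x) (xi_measurable P) hc
  refine ⟨ε, hε, ?_⟩
  simp_rw [ball_measure f hf ν hg]
  exact h

lemma exists_small_part {ε : ℝ} (hε : 0 < ε) :
    ∃ P : FinMeasPartition T, ∀ x y, y ∈ P.part x → dist x y < ε := by
  obtain ⟨t, -, htf, hcov⟩ := (isCompact_univ (X := T)).finite_cover_balls (half_pos hε)
  let S : T → Set T := fun y => {c | c ∈ t ∧ dist y c < ε / 2}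
  refine ⟨⟨fun x => {y | S y = S x}, fun x => rfl, fun x => ?_, fun x y h => ?_, ?_⟩, ?_⟩
  · have : {y | S y = S x} = ⋂ c ∈ t, {y | dist y c < ε / 2 ↔ dist x c < ε / 2} := by
      ext y
      simp only [S, Set.ext_iff, Set.mem_iInter, Set.mem_ofPred_eq]
      exact ⟨fun h c hc => by have := h c; tauto, fun h c => by have := h c; tauto⟩
    rw [this]
    refine MeasurableSet.biInter htf.countable fun c _ => ?_
    have hm : MeasurableSet {y | dist y c < ε / 2} :=
      (isOpen_lt (continuous_id.dist continuous_const) continuous_const).measurableSet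
    by_cases h : dist x c < ε / 2
    · simpa [h] using hm
    · have e : {y | dist y c < ε / 2 ↔ dist x c < ε / 2} = {y | dist y c < ε / 2}ᶜ := by
        ext y; simp [h]
      rw [e]; exact hm.compl
  · have h' : S y = S x := h
    simp only [h']
  · refine (htf.powerset.image fun R => {y | S y = R}).subset ?_
    rintro _ ⟨x, rfl⟩
    exact ⟨S x, fun c hc => hc.1, rfl⟩
  · intro x y h
    have h' : S y = S x := h
    have hx := hcov (Set.mem_univ x)
    simp only [Set.mem_iUnion, Metric.mem_ball, exists_prop] at hx
    obtain ⟨c, hct, hc⟩ := hx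
    have h1 : c ∈ S x := ⟨hct, hc⟩
    rw [← h'] at h1
    have := dist_triangle_right x y c
    linarith [h1.2]

lemma final_upper (f : Equiv.Perm T) (hf : Continuous f) (hf' : Continuous f.symm)
    (ν : Measure T) [IsProbabilityMeasure ν] (herg : Ergodic (⇑f) ν)
    (hfin : ksEntropy f ν ≠ ⊤) {ε c : ℝ} (hε : 0 < ε) (hc : (ksEntropy f ν).toReal < c) :
    ∀ᵐ t ∂ν, ∀ᶠ n : ℕ in atTop, -Real.log (ν (twoSidedBall f n t ε)).toReal ≤ 2 * n * c := by
  have hg := ergodic_symm f hf hf' ν herg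
  obtain ⟨P, hP⟩ := exists_small_part (T := T) hε
  have hpe : partitionEntropy f ν P < c := by
    refine lt_of_le_of_lt ?_ hc
    rw [← ENNReal.ofReal_le_iff_le_toReal hfin]
    exact le_iSup (fun P => ENNReal.ofReal (partitionEntropy f ν P)) P
  obtain ⟨k, hk1, hk⟩ := (((pe_tendsto f ν herg.toMeasurePreserving P).2.eventually_lt_const
    hpe).and (eventually_gt_atTop 0)).exists
  have hk0 : (0:ℝ) < k := Nat.cast_pos.2 hk
  rw [div_lt_iff₀ hk0] at hk1
  have h1 := upper_smb herg hg (fun x => f.apply_symm_apply x) (xi_measurable P) hk hk1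
  have h2 : ∀ᵐ t ∂ν, ∀ n : ℕ, 0 < cm ν f (xi P) (2 * n + 1) ((⇑f.symm)^[n] t) := by
    rw [ae_all_iff]
    intro n
    exact (hg.toMeasurePreserving.iterate n).quasiMeasurePreserving.ae
      (fiber_pos (word f (xi P) (2 * n + 1)))
  filter_upwards [h1, h2] with t ht1 ht2
  filter_upwards [ht1] with n hn
  rw [ball_measure f hf ν hg]
  have h3 : info ν f (xi P) (2 * n + 1) ((⇑f.symm)^[n] t) ≤ 2 * n * c := by
    have : (k:ℝ) * info ν f (xi P) (2 * n + 1) ((⇑f.symm)^[n] t) ≤ k * (2 * n * c) := by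
      refine hn.trans (le_of_eq ?_); ring
    exact le_of_mul_le_mul_left this hk0
  refine le_trans ?_ h3
  rw [info]
  refine neg_le_neg (Real.log_le_log (ht2 n) ?_)
  rw [cm]
  refine measureReal_mono ?_ (measure_ne_top _ _)
  intro s hs j hj
  have hs' := congrFun (hs : word f (xi P) (2 * n + 1) s = _) ⟨j, hj⟩
  simp only [word] at hs'
  exact hP _ _ ((xi_eq_iff P _ _).1 hs')

lemma exists_part (f : Equiv.Perm T)
    (ν : Measure T) [IsProbabilityMeasure ν] (herg : Ergodic (⇑f) ν) {c : ℝ}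
    (hc : c < (ksEntropy f ν).toReal) : ∃ P : FinMeasPartition T, c < partitionEntropy f ν P := by
  by_contra hcon
  push Not at hcon
  have h1 : ksEntropy f ν ≤ ENNReal.ofReal c := iSup_le fun P => ENNReal.ofReal_le_ofReal (hcon P)
  have h2 := ENNReal.toReal_mono ENNReal.ofReal_ne_top h1
  rcases le_or_gt 0 c with h0 | h0
  · rw [ENNReal.toReal_ofReal h0] at h2; linarith
  · obtain ⟨P, -⟩ := exists_small_part (T := T) one_pos
    have : 0 ≤ partitionEntropy f ν P := by
      refine ge_of_tendsto' (pe_tendsto f ν herg.toMeasurePreserving P).2 fun n => ?_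
      exact div_nonneg (integral_nonneg fun x => info_nonneg _ _ _ _ _) n.cast_nonneg
    linarith [hcon P]

end Bridge
end BK

theorem stmt11 (f : Equiv.Perm T) (hf : Continuous f) (hf' : Continuous f.symm)
    (ν : Measure T) [IsProbabilityMeasure ν] (herg : Ergodic (⇑f) ν)
    (hfin : ksEntropy f ν ≠ ⊤) :
    ∀ᵐ t ∂ν,
      (⨆ ε : {e : ℝ // 0 < e}, Filter.liminf
          (fun n : ℕ => ((-Real.log (ν (twoSidedBall f n t ε)).toReal / n : ℝ) : EReal))
          Filter.atTop) = ((2 * (ksEntropy f ν).toReal : ℝ) : EReal) ∧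
      (⨆ ε : {e : ℝ // 0 < e}, Filter.limsup
          (fun n : ℕ => ((-Real.log (ν (twoSidedBall f n t ε)).toReal / n : ℝ) : EReal))
          Filter.atTop) = ((2 * (ksEntropy f ν).toReal : ℝ) : EReal) := by
  set h := (ksEntropy f ν).toReal with hh
  have hlow : ∀ k : ℕ, ∃ ε > 0, ∀ᵐ t ∂ν, ∀ᶠ n : ℕ in atTop,
      (ν (twoSidedBall f n t ε)).toReal ≤ Real.exp (-(h - 1 / ((k:ℝ) + 1)) * (2 * n + 1 : ℕ)) := by
    intro k
    have hk : h - 1 / ((k:ℝ) + 1) < h := by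
      have : 0 < 1 / ((k:ℝ) + 1) := by positivity
      linarith
    obtain ⟨P, hP⟩ := BK.exists_part f ν herg hk
    exact BK.final_lower f hf hf' ν herg P hP
  choose E hE0 hE using hlow
  have hup : ∀ m k : ℕ, ∀ᵐ t ∂ν, ∀ᶠ n : ℕ in atTop,
      -Real.log (ν (twoSidedBall f n t (1 / ((m:ℝ) + 1)))).toReal ≤
        2 * n * (h + 1 / ((k:ℝ) + 1)) := by
    intro m k
    refine BK.final_upper f hf hf' ν herg hfin (by positivity) ?_
    have : 0 < 1 / ((k:ℝ) + 1) := by positivity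
    linarith
  have hinv : Tendsto (fun k : ℕ => 1 / ((k:ℝ) + 1)) atTop (nhds 0) :=
    tendsto_one_div_add_atTop_nhds_zero_nat
  filter_upwards [BK.ball_pos f hf hf' ν, ae_all_iff.2 hE,
    ae_all_iff.2 fun m => ae_all_iff.2 (hup m)] with t hpos hl hu
  have hle : (⨆ ε : {e : ℝ // 0 < e}, Filter.liminf
          (fun n : ℕ => ((-Real.log (ν (twoSidedBall f n t ε)).toReal / n : ℝ) : EReal))
          Filter.atTop) ≤ (⨆ ε : {e : ℝ // 0 < e}, Filter.limsup
          (fun n : ℕ => ((-Real.log (ν (twoSidedBall f n t ε)).toReal / n : ℝ) : EReal))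
          Filter.atTop) := iSup_mono fun ε => liminf_le_limsup
  have hA : ((2 * h : ℝ) : EReal) ≤ (⨆ ε : {e : ℝ // 0 < e}, Filter.liminf
          (fun n : ℕ => ((-Real.log (ν (twoSidedBall f n t ε)).toReal / n : ℝ) : EReal))
          Filter.atTop) := by
    have ht : Tendsto (fun k : ℕ => ((2 * (h - 1 / ((k:ℝ) + 1)) : ℝ) : EReal)) atTop
        (nhds ((2 * h : ℝ) : EReal)) := by
      refine (continuous_coe_real_ereal.tendsto _).comp ?_
      have := (hinv.const_sub h).const_mul 2
      simpa using this
    refine le_of_tendsto' ht fun k => ?_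
    refine le_trans ?_ (le_iSup _ (⟨E k, hE0 k⟩ : {e : ℝ // 0 < e}))
    set c := h - 1 / ((k:ℝ) + 1) with hc
    have ht2 : Tendsto (fun n : ℕ => ((2 * c + c / n : ℝ) : EReal)) atTop
        (nhds ((2 * c : ℝ) : EReal)) := by
      refine (continuous_coe_real_ereal.tendsto _).comp ?_
      have := (tendsto_const_div_atTop_nhds_zero_nat c).const_add (2 * c)
      simpa using this
    rw [← ht2.liminf_eq]
    refine liminf_le_liminf ?_
    filter_upwards [hl k, eventually_gt_atTop 0] with n hn hn0
    rw [EReal.coe_le_coe_iff]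
    have hn1 : (0:ℝ) < n := Nat.cast_pos.2 hn0
    rw [le_div_iff₀ hn1]
    have h1 := Real.log_le_log (hpos n (E k) (hE0 k)) hn
    rw [Real.log_exp] at h1
    push_cast at h1
    have e : (2 * c + c / n) * n = c * (2 * n + 1) := by field_simp
    rw [e]
    linarith
  have hB : (⨆ ε : {e : ℝ // 0 < e}, Filter.limsup
          (fun n : ℕ => ((-Real.log (ν (twoSidedBall f n t ε)).toReal / n : ℝ) : EReal))
          Filter.atTop) ≤ ((2 * h : ℝ) : EReal) := by
    refine iSup_le fun ε => ?_
    obtain ⟨m, hm⟩ := exists_nat_one_div_lt ε.2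
    have ht : Tendsto (fun k : ℕ => ((2 * (h + 1 / ((k:ℝ) + 1)) : ℝ) : EReal)) atTop
        (nhds ((2 * h : ℝ) : EReal)) := by
      refine (continuous_coe_real_ereal.tendsto _).comp ?_
      have := (hinv.const_add h).const_mul 2
      simpa using this
    refine ge_of_tendsto' ht fun k => ?_
    refine limsup_le_of_le (h := ?_)
    filter_upwards [hu m k, eventually_gt_atTop 0] with n hn hn0
    rw [EReal.coe_le_coe_iff]
    have hn1 : (0:ℝ) < n := Nat.cast_pos.2 hn0
    rw [div_le_iff₀ hn1]
    have h1 : Real.log (ν (twoSidedBall f n t (1 / ((m:ℝ) + 1)))).toReal ≤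
        Real.log (ν (twoSidedBall f n t ε)).toReal := by
      refine Real.log_le_log (hpos n _ (by positivity)) ?_
      exact ENNReal.toReal_mono (measure_ne_top _ _) (measure_mono (BK.ball_mono f n t hm.le))
    linarith
  exact ⟨le_antisymm (hle.trans hB) hA, le_antisymm hB (hA.trans hle)⟩
end

section
/- Let f : T → T be a homeomorphism of a compact metric space and ν an ergodic f-invariant Borel probability measure with h_ν(f) < ∞. Then for ν-almost every t, sup_{ε>0} limsup_{n→∞} −(1/n) log ν(B_n^{f,±}(t,ε)) ≤ 2·h_ν(f), where B_n^{f,±}(t,ε) is the two-sided Bowen ball {s : max_{−n≤i≤n} d(fⁱ(t),fⁱ(s)) < ε}. -/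
open Filter MeasureTheory
open scoped ENNReal

variable {T : Type*} [MetricSpace T] [CompactSpace T] [MeasurableSpace T] [BorelSpace T]

lemma birk_upper {ν : Measure T} [IsProbabilityMeasure ν] {g : T → T} (hg : Ergodic g ν)
    {ψ : T → ℝ} (hm : Measurable ψ) (hi : Integrable ψ ν) (hneg : ∫ x, ψ x ∂ν < 0) :
    ∀ᵐ x ∂ν, ∃ B : ℝ, ∀ n, birkhoffSum g ψ n x ≤ B := by
  have hgm : Measurable g := hg.measurable
  have hSm : ∀ n, Measurable (birkhoffSum g ψ n) := by
    intro n
    induction n with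
    | zero => 
      have : birkhoffSum g ψ 0 = fun _ => 0 := by ext x; simp
      rw [this]; exact measurable_const
    | succ n ih =>
      have : birkhoffSum g ψ (n+1) = fun x => ψ x + birkhoffSum g ψ n (g x) := by
        ext x; exact birkhoffSum_succ' g ψ n x
      rw [this]; exact hm.add (ih.comp hgm)
  let F : Set T := {x | ∃ B : ℝ, ∀ n, birkhoffSum g ψ n x ≤ B}
  have hF : F = ⋃ b : ℕ, ⋂ n, {x | birkhoffSum g ψ n x ≤ b} := by
    ext x
    simp only [F, Set.mem_ofPred_eq, Set.mem_iUnion, Set.mem_iInter]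
    constructor
    · rintro ⟨B, hB⟩
      obtain ⟨b, hb⟩ := exists_nat_ge B
      exact ⟨b, fun n => (hB n).trans hb⟩
    · rintro ⟨b, hb⟩
      exact ⟨b, hb⟩
  have hFm : MeasurableSet F := by
    rw [hF]
    exact MeasurableSet.iUnion fun b => MeasurableSet.iInter fun n =>
      measurableSet_le (hSm n) measurable_const
  have hinv : g ⁻¹' F = F := by
    ext x
    simp only [F, Set.mem_preimage, Set.mem_ofPred_eq]
    constructor
    · rintro ⟨B, hB⟩
      refine ⟨max 0 (ψ x + B), fun n => ?_⟩
      cases n with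
      | zero => simp
      | succ n => 
        rw [birkhoffSum_succ']
        exact le_max_of_le_right (by linarith [hB n])
    · rintro ⟨B, hB⟩
      refine ⟨B - ψ x, fun n => ?_⟩
      have := hB (n+1)
      rw [birkhoffSum_succ'] at this
      linarith
  rcases hg.toPreErgodic.measure_self_or_compl_eq_zero hFm hinv with h0 | h0
  swap
  · exact h0
  exfalso
  let M : ℕ → T → ℝ := fun n => Nat.rec (fun _ => 0) (fun _ m x => max 0 (ψ x + m (g x))) n
  have M0 : ∀ x, M 0 x = 0 := fun x => rfl
  have MS : ∀ n x, M (n+1) x = max 0 (ψ x + M n (g x)) := fun n x => rfl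
  have Mnn : ∀ n x, 0 ≤ M n x := by
    intro n x
    cases n with
    | zero => exact (M0 x).ge
    | succ n => rw [MS]; exact le_max_left _ _
  have Mmono : ∀ n x, M n x ≤ M (n+1) x := by
    intro n
    induction n with
    | zero => intro x; rw [M0]; exact Mnn (0+1) x
    | succ n ih => 
      intro x; rw [MS, MS (n+1)]
      exact max_le_max le_rfl (by linarith [ih (g x)])
  have MgeS : ∀ n x, birkhoffSum g ψ n x ≤ M n x := by
    intro n
    induction n with
    | zero => intro x; simp [M0]
    | succ n ih =>
      intro x; rw [MS, birkhoffSum_succ']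
      exact le_max_of_le_right (by linarith [ih (g x)])
  have Mint : ∀ n, Integrable (M n) ν := by
    intro n
    induction n with
    | zero => exact integrable_zero _ _ _
    | succ n ih =>
      have h1 : Integrable (fun x => M n (g x)) ν := 
        hg.toMeasurePreserving.integrable_comp_of_integrable ih
      exact (integrable_zero _ _ _).sup (hi.add h1)
  have MgI : ∀ n, Integrable (fun x => M n (g x)) ν := fun n => 
    hg.toMeasurePreserving.integrable_comp_of_integrable (Mint n)
  have MgE : ∀ n, ∫ x, M n (g x) ∂ν = ∫ x, M n x ∂ν := by
    intro n
    have h := hg.toMeasurePreserving.map_eq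
    have h2 : AEStronglyMeasurable (M n) (Measure.map g ν) := by rw [h]; exact (Mint n).1
    have := integral_map hgm.aemeasurable h2
    rw [h] at this
    exact this.symm
  have hlim : Tendsto (fun n => ∫ x, (M (n+1) x - M n (g x)) ∂ν) atTop (nhds (∫ x, ψ x ∂ν)) := by
    apply tendsto_integral_of_dominated_convergence (fun x => |ψ x|)
    · intro n; exact ((Mint (n+1)).sub (MgI n)).1
    · exact hi.abs
    · intro n
      refine Eventually.of_forall fun x => ?_
      rw [MS, Real.norm_eq_abs]
      have := Mnn n (g x)
      rcases le_total 0 (ψ x + M n (g x)) with h | h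
      · rw [max_eq_right h]; simp
      · rw [max_eq_left h, zero_sub, abs_neg, abs_of_nonneg this]
        linarith [neg_le_abs (ψ x)]
    · have : ∀ᵐ x ∂ν, x ∉ F := measure_eq_zero_iff_ae_notMem.1 h0
      filter_upwards [this] with x hx
      have hgx : g x ∉ F := by
        intro h; apply hx; rw [← hinv]; exact h
      have : ∃ n, -ψ x < birkhoffSum g ψ n (g x) := by
        by_contra! hcon
        exact hgx ⟨_, hcon⟩
      obtain ⟨n, hn⟩ := this
      apply tendsto_const_nhds.congr'
      filter_upwards [eventually_ge_atTop n] with m hmn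
      have hmono : Monotone (fun n => M n (g x)) := monotone_nat_of_le_succ (fun n => Mmono n _)
      have h1 : M n (g x) ≤ M m (g x) := hmono hmn
      have h2 := MgeS n (g x)
      rw [MS, max_eq_right (by linarith)]
      ring
  have : 0 ≤ ∫ x, ψ x ∂ν := by
    apply ge_of_tendsto' hlim
    intro n
    have e := integral_sub (Mint (n+1)) (MgI n)
    rw [MgE] at e
    change 0 ≤ ∫ x, (M (n+1) x - M n (g x)) ∂ν
    refine le_of_le_of_eq ?_ e.symm
    linarith [integral_mono (Mint n) (Mint (n+1)) (Mmono n)]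
  linarith

section words

variable {ι : Type*} [Fintype ι] [DecidableEq ι]

def word (f : T → T) (a : T → ι) : ℕ → T → List ι
  | 0, _ => []
  | n+1, x => a x :: word f a n (f x)

def cyl (f : T → T) (a : T → ι) : List ι → Set T
  | [] => Set.univ
  | b :: l => {x | a x = b ∧ f x ∈ cyl f a l}

def wset (ι : Type*) [Fintype ι] [DecidableEq ι] : ℕ → Finset (List ι)
  | 0 => {[]}
  | n+1 => (Finset.univ ×ˢ wset ι n).image (fun p : ι × List ι => p.1 :: p.2)

lemma sum_wset_succ (n : ℕ) (F : List ι → ℝ) :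
    ∑ w ∈ wset ι (n+1), F w = ∑ w ∈ wset ι n, ∑ b : ι, F (b :: w) := by
  rw [wset, Finset.sum_image, Finset.sum_product_right]
  rintro ⟨b, l⟩ _ ⟨b', l'⟩ _ h
  simpa using h

lemma card_wset (n : ℕ) : (wset ι n).card = (Fintype.card ι)^n := by
  induction n with
  | zero => simp [wset]
  | succ n ih =>
    rw [wset, Finset.card_image_of_injective, Finset.card_product, ih, Finset.card_univ, pow_succ']
    rintro ⟨b, l⟩ ⟨b', l'⟩ h
    simpa using h

lemma word_mem (f : T → T) (a : T → ι) (n : ℕ) (x : T) : word f a n x ∈ wset ι n := by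
  induction n generalizing x with
  | zero => simp [wset, word]
  | succ n ih => 
    simp only [wset, word, Finset.mem_image, Finset.mem_product]
    exact ⟨(a x, word f a n (f x)), ⟨Finset.mem_univ _, ih _⟩, rfl⟩

lemma mem_cyl_iff (f : T → T) (a : T → ι) (n : ℕ) (x : T) (w : List ι) (hw : w ∈ wset ι n) :
    x ∈ cyl f a w ↔ word f a n x = w := by
  induction n generalizing x w with
  | zero => 
    simp only [wset, Finset.mem_singleton] at hw
    subst hw; simp [cyl, word]
  | succ n ih =>
    simp only [wset, Finset.mem_image, Finset.mem_product] at hw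
    obtain ⟨⟨b, l⟩, ⟨_, hl⟩, rfl⟩ := hw
    simp [cyl, word, ih (f x) l hl]

lemma take_word (f : T → T) (a : T → ι) (k n : ℕ) (x : T) :
    (word f a n x).take k = word f a (min k n) x := by
  induction n generalizing x k with
  | zero => simp [word]
  | succ n ih =>
    cases k with
    | zero => simp [word]
    | succ k => rw [Nat.succ_min_succ]; simp [word, ih]

lemma meas_cyl {f : T → T} (hf : Measurable f) {a : T → ι} (ha : ∀ b, MeasurableSet {x | a x = b})
    (w : List ι) : MeasurableSet (cyl f a w) := by
  induction w with
  | nil => exact MeasurableSet.univ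
  | cons b l ih => exact (ha b).inter (hf ih)

lemma word_fun_eq (f : T → T) (a : T → ι) (n : ℕ) (F : List ι → ℝ) :
    (fun x => F (word f a n x)) = 
      fun x => ∑ w ∈ wset ι n, (cyl f a w).indicator (fun _ => F w) x := by
  ext x
  rw [Finset.sum_eq_single (word f a n x)]
  · rw [Set.indicator_of_mem]
    exact (mem_cyl_iff f a n x _ (word_mem f a n x)).2 rfl
  · intro w hw hne
    rw [Set.indicator_of_notMem]
    intro h
    exact hne ((mem_cyl_iff f a n x w hw).1 h).symm
  · intro h; exact absurd (word_mem f a n x) h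

variable {f : T → T} {a : T → ι} (ν : Measure T) [IsProbabilityMeasure ν]

lemma word_fun_meas (hf : Measurable f) (ha : ∀ b, MeasurableSet {x | a x = b}) (n : ℕ)
    (F : List ι → ℝ) : Measurable (fun x => F (word f a n x)) := by
  rw [word_fun_eq]
  exact Finset.measurable_sum _ fun w _ => measurable_const.indicator (meas_cyl hf ha w)

lemma word_fun_int (hf : Measurable f) (ha : ∀ b, MeasurableSet {x | a x = b}) (n : ℕ)
    (F : List ι → ℝ) : Integrable (fun x => F (word f a n x)) ν := by
  rw [word_fun_eq]
  exact integrable_finsetSum _ fun w _ => (integrable_const _).indicator (meas_cyl hf ha w)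

lemma word_fun_integral (hf : Measurable f) (ha : ∀ b, MeasurableSet {x | a x = b}) (n : ℕ)
    (F : List ι → ℝ) : ∫ x, F (word f a n x) ∂ν = ∑ w ∈ wset ι n, ν.real (cyl f a w) * F w := by
  rw [word_fun_eq, integral_finsetSum]
  · refine Finset.sum_congr rfl fun w _ => ?_
    rw [integral_indicator_const _ (meas_cyl hf ha w), smul_eq_mul]
  · exact fun w _ => (integrable_const _).indicator (meas_cyl hf ha w)

/-- Markov approximation of order `k`. -/
noncomputable def Qm (f : T → T) (a : T → ι) (ν : Measure T) (k : ℕ) : List ι → ℝ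
  | [] => 1
  | b :: l => Qm f a ν k l * (ν.real (cyl f a (b :: l.take k)) / ν.real (cyl f a (l.take k)))

lemma Qm_nonneg (k : ℕ) (l : List ι) : 0 ≤ Qm f a ν k l := by
  induction l with
  | nil => simp [Qm]
  | cons b l ih => rw [Qm]; positivity

lemma sum_cyl_cons (hf : MeasurePreserving f ν ν) (ha : ∀ b, MeasurableSet {x | a x = b})
    (l : List ι) : ∑ b : ι, ν.real (cyl f a (b :: l)) = ν.real (cyl f a l) := by
  have h1 : f ⁻¹' (cyl f a l) = ⋃ b ∈ (Finset.univ : Finset ι), cyl f a (b :: l) := by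
    ext x; simp [cyl]
  rw [← hf.measureReal_preimage (meas_cyl hf.measurable ha l).nullMeasurableSet, h1,
    measureReal_biUnion_finset]
  · intro b _ c _ hbc
    refine Set.disjoint_left.2 fun x hx hy => hbc ?_
    exact hx.1.symm.trans hy.1
  · exact fun b _ => meas_cyl hf.measurable ha _

lemma sum_Qm (hf : MeasurePreserving f ν ν) (ha : ∀ b, MeasurableSet {x | a x = b}) (k n : ℕ) :
    ∑ w ∈ wset ι n, Qm f a ν k w ≤ 1 := by
  induction n with
  | zero => simp [wset, Qm]
  | succ n ih =>
    rw [sum_wset_succ]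
    refine le_trans (Finset.sum_le_sum fun w _ => ?_) ih
    simp only [Qm]
    rw [← Finset.mul_sum, ← Finset.sum_div, sum_cyl_cons ν hf ha]
    exact mul_le_of_le_one_right (Qm_nonneg ν k w) (div_self_le_one _)

lemma markov_bound (hf : MeasurePreserving f ν ν) (ha : ∀ b, MeasurableSet {x | a x = b})
    (k n : ℕ) (δ : ℝ) (hδ : 0 ≤ δ) :
    ν {x | ν.real (cyl f a (word f a n x)) ≤ Qm f a ν k (word f a n x) * δ} ≤ 
      ENNReal.ofReal δ := by
  have hsub : {x | ν.real (cyl f a (word f a n x)) ≤ Qm f a ν k (word f a n x) * δ} ⊆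
      ⋃ w ∈ (wset ι n).filter (fun w => ν.real (cyl f a w) ≤ Qm f a ν k w * δ), cyl f a w := by
    intro x hx
    simp only [Set.mem_iUnion, Finset.mem_filter]
    exact ⟨_, ⟨word_mem f a n x, hx⟩, (mem_cyl_iff f a n x _ (word_mem f a n x)).2 rfl⟩
  rw [← ofReal_measureReal]
  apply ENNReal.ofReal_le_ofReal
  calc _ ≤ ν.real (⋃ w ∈ (wset ι n).filter (fun w => ν.real (cyl f a w) ≤ Qm f a ν k w * δ), 
        cyl f a w) := measureReal_mono hsub (measure_ne_top _ _)
    _ ≤ ∑ w ∈ (wset ι n).filter (fun w => ν.real (cyl f a w) ≤ Qm f a ν k w * δ), 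
        ν.real (cyl f a w) := measureReal_biUnion_finset_le _ _
    _ ≤ ∑ w ∈ (wset ι n).filter (fun w => ν.real (cyl f a w) ≤ Qm f a ν k w * δ), 
        Qm f a ν k w * δ := Finset.sum_le_sum fun w hw => (Finset.mem_filter.1 hw).2
    _ ≤ ∑ w ∈ wset ι n, Qm f a ν k w * δ := 
        Finset.sum_le_sum_of_subset_of_nonneg (Finset.filter_subset _ _) 
          fun w _ _ => mul_nonneg (Qm_nonneg ν k w) hδ
    _ ≤ 1 * δ := by
        rw [← Finset.sum_mul]
        exact mul_le_mul_of_nonneg_right (sum_Qm ν hf ha k n) hδ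
    _ = δ := one_mul _

lemma ae_good : ∀ᵐ x ∂ν, ∀ j, 0 < ν.real (cyl f a (word f a j x)) := by
  rw [ae_all_iff]
  intro j
  have : ν (⋃ w ∈ (wset ι j).filter (fun w => ν (cyl f a w) = 0), cyl f a w) = 0 := by
    refine (measure_biUnion_null_iff (Finset.countable_toSet
      ((wset ι j).filter (fun w => ν (cyl f a w) = 0)))).2 ?_
    intro w hw
    exact (Finset.mem_filter.1 hw).2
  refine measure_mono_null ?_ this
  intro x hx
  simp only [Set.mem_iUnion, Finset.mem_filter]
  refine ⟨_, ⟨word_mem f a j x, ?_⟩, (mem_cyl_iff f a j x _ (word_mem f a j x)).2 rfl⟩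
  by_contra h
  exact hx (ENNReal.toReal_pos h (measure_ne_top _ _))

/-- conditional information function. -/
noncomputable def phi (f : T → T) (a : T → ι) (ν : Measure T) (k : ℕ) (x : T) : ℝ :=
  Real.log (ν.real (cyl f a (word f a k (f x)))) - Real.log (ν.real (cyl f a (word f a (k+1) x)))

lemma good_map (hf : MeasurePreserving f ν ν) (ha : ∀ b, MeasurableSet {x | a x = b}) {x : T} 
    (hx : ∀ j, 0 < ν.real (cyl f a (word f a j x))) (j : ℕ) : 
    0 < ν.real (cyl f a (word f a j (f x))) := by
  refine (hx (j+1)).trans_le ?_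
  rw [← hf.measureReal_preimage
    (meas_cyl hf.measurable ha (word f a j (f x))).nullMeasurableSet]
  exact measureReal_mono fun y hy => hy.2

lemma lw_bound (j : ℕ) (x : T) : |Real.log (ν.real (cyl f a (word f a j x)))| ≤ 
    ∑ w ∈ wset ι j, |Real.log (ν.real (cyl f a w))| :=
  Finset.single_le_sum (f := fun w => |Real.log (ν.real (cyl f a w))|) 
    (fun _ _ => abs_nonneg _) (word_mem f a j x)

lemma log_Qm (hf : MeasurePreserving f ν ν) (ha : ∀ b, MeasurableSet {x | a x = b}) (k : ℕ) :
    ∃ K : ℝ, ∀ x, (∀ j, 0 < ν.real (cyl f a (word f a j x))) → ∀ n, 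
      0 < Qm f a ν k (word f a n x) ∧ 
      -Real.log (Qm f a ν k (word f a n x)) ≤ birkhoffSum f (phi f a ν k) n x + K := by
  obtain ⟨K, hK0, hK⟩ : ∃ K : ℝ, 0 ≤ K ∧ ∀ j ≤ k, ∀ x, phi f a ν j x ≤ phi f a ν k x + K := by
    let L : ℝ := ∑ j ∈ Finset.range (k+2), ∑ w ∈ wset ι j, |Real.log (ν.real (cyl f a w))|
    have hL : ∀ j ≤ k+1, ∀ x, |Real.log (ν.real (cyl f a (word f a j x)))| ≤ L := by
      intro j hj x
      refine (lw_bound ν j x).trans ?_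
      exact Finset.single_le_sum 
        (f := fun j => ∑ w ∈ wset ι j, |Real.log (ν.real (cyl f a w))|)
        (fun _ _ => Finset.sum_nonneg fun _ _ => abs_nonneg _) (Finset.mem_range.2 (by omega))
    refine ⟨4 * |L|, by positivity, fun j hj x => ?_⟩
    have h1 := abs_le.1 (hL j (by omega) (f x))
    have h2 := abs_le.1 (hL (j+1) (by omega) x)
    have h3 := abs_le.1 (hL k (by omega) (f x))
    have h4 := abs_le.1 (hL (k+1) (by omega) x)
    have := le_abs_self L
    simp only [phi]
    linarith
  have main : ∀ n x, (∀ j, 0 < ν.real (cyl f a (word f a j x))) →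
      0 < Qm f a ν k (word f a n x) ∧ 
      -Real.log (Qm f a ν k (word f a n x)) ≤ 
        birkhoffSum f (phi f a ν k) n x + K * (min k n : ℕ) := by
    intro n
    induction n with
    | zero => intro x hx; simp [word, Qm]
    | succ n ih =>
      intro x hx
      obtain ⟨h1, h2⟩ := ih (f x) (good_map ν hf ha hx)
      have e : Qm f a ν k (word f a (n+1) x) = Qm f a ν k (word f a n (f x)) * 
          (ν.real (cyl f a (word f a (min k n + 1) x)) / 
            ν.real (cyl f a (word f a (min k n) (f x)))) := by
        rw [word, Qm, take_word]; rfl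
      have p1 := hx (min k n + 1)
      have p2 := good_map ν hf ha hx (min k n)
      refine ⟨by rw [e]; positivity, ?_⟩
      rw [e, Real.log_mul h1.ne' (by positivity), Real.log_div p1.ne' p2.ne', birkhoffSum_succ']
      have h3 : phi f a ν (min k n) x + K * (min k n : ℕ) ≤ 
          phi f a ν k x + K * (min k (n+1) : ℕ) := by
        rcases le_or_gt k n with h | h
        · rw [min_eq_left h, min_eq_left (by omega)]
        · rw [min_eq_right h.le, min_eq_right (by omega)]
          have := hK n h.le x
          push_cast
          linarith
      have h4 : phi f a ν (min k n) x = Real.log (ν.real (cyl f a (word f a (min k n) (f x)))) - 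
        Real.log (ν.real (cyl f a (word f a (min k n+1) x))) := rfl
      linarith
  refine ⟨K * k, fun x hx n => ⟨(main n x hx).1, (main n x hx).2.trans ?_⟩⟩
  have : ((min k n : ℕ) : ℝ) ≤ k := by exact_mod_cast min_le_left k n
  nlinarith

lemma entropy_bound (hf : Measurable f) (ha : ∀ b, MeasurableSet {x | a x = b}) (n : ℕ) :
    ∫ x, -Real.log (ν.real (cyl f a (word f a n x))) ∂ν ≤ n * Real.log (Fintype.card ι) := by
  have : Nonempty T := nonempty_of_isProbabilityMeasure ν
  have hc : 0 < (Fintype.card ι : ℝ) := by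
    have : Nonempty ι := ⟨a (Classical.arbitrary T)⟩
    exact_mod_cast Fintype.card_pos
  have h1 : ∑ w ∈ wset ι n, ν.real (cyl f a w) = 1 := by
    have := word_fun_integral ν hf ha n (fun _ => 1)
    simpa using this.symm
  rw [word_fun_integral ν hf ha n (fun w => -Real.log (ν.real (cyl f a w)))]
  set L : ℝ := (Fintype.card ι : ℝ)
  have h2 : ∀ w ∈ wset ι n, ν.real (cyl f a w) * -Real.log (ν.real (cyl f a w)) ≤ 
      ν.real (cyl f a w) * (n * Real.log L - 1) + (L^n)⁻¹ := by
    intro w _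
    rcases (measureReal_nonneg (μ := ν) (s := cyl f a w)).eq_or_lt with h | h
    · rw [← h]; simp; positivity
    · have := Real.log_le_sub_one_of_pos (x := (L^n)⁻¹ / ν.real (cyl f a w)) (by positivity)
      rw [Real.log_div (by positivity) h.ne', Real.log_inv, Real.log_pow] at this
      have h5 := mul_le_mul_of_nonneg_left this h.le
      have h6 : ν.real (cyl f a w) * ((L^n)⁻¹ / ν.real (cyl f a w)) = (L^n)⁻¹ := by
        field_simp
      nlinarith
  refine (Finset.sum_le_sum h2).trans ?_
  rw [Finset.sum_add_distrib, ← Finset.sum_mul, h1, Finset.sum_const, card_wset]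
  have : ((Fintype.card ι)^n) • (L^n)⁻¹ = 1 := by
    rw [nsmul_eq_mul]; push_cast; exact mul_inv_cancel₀ (by positivity)
  rw [this]; linarith

lemma exists_k (hf : MeasurePreserving f ν ν) (ha : ∀ b, MeasurableSet {x | a x = b}) (c : ℝ)
    (hc : liminf (fun n : ℕ => 
      (∫ x, -Real.log (ν.real (cyl f a (word f a n x))) ∂ν) / n) atTop < c) : 
    ∃ k, ∫ x, phi f a ν k x ∂ν < c := by
  by_contra! hcon
  have hphi : ∀ k, ∫ x, phi f a ν k x ∂ν = 
      (∫ x, -Real.log (ν.real (cyl f a (word f a (k+1) x))) ∂ν) - 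
      (∫ x, -Real.log (ν.real (cyl f a (word f a k x))) ∂ν) := by
    intro k
    have i1 := word_fun_int ν hf.measurable ha k (fun w => Real.log (ν.real (cyl f a w)))
    have i2 := word_fun_int ν hf.measurable ha (k+1) (fun w => Real.log (ν.real (cyl f a w)))
    have i3 : Integrable (fun x => Real.log (ν.real (cyl f a (word f a k (f x))))) ν :=
      hf.integrable_comp_of_integrable i1
    have e3 : ∫ x, Real.log (ν.real (cyl f a (word f a k (f x)))) ∂ν = 
        ∫ x, Real.log (ν.real (cyl f a (word f a k x))) ∂ν := by
      have h2 : AEStronglyMeasurable (fun x => Real.log (ν.real (cyl f a (word f a k x)))) 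
        (Measure.map f ν) := by rw [hf.map_eq]; exact i1.1
      have := integral_map hf.measurable.aemeasurable h2
      rw [hf.map_eq] at this
      exact this.symm
    simp only [phi]
    rw [integral_sub i3 i2, e3, integral_neg, integral_neg]
    ring
  have hsum : ∀ n : ℕ, n * c ≤ ∫ x, -Real.log (ν.real (cyl f a (word f a n x))) ∂ν := by
    intro n
    induction n with
    | zero => simp [word, cyl]
    | succ n ih =>
      have := hcon n
      rw [hphi] at this
      push_cast
      linarith
  refine absurd hc (not_lt.2 ?_)
  apply le_liminf_of_le
  · apply IsBoundedUnder.isCoboundedUnder_ge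
    refine ⟨Real.log (Fintype.card ι), ?_⟩
    rw [eventually_map]
    filter_upwards [eventually_gt_atTop 0] with n hn
    have : (0:ℝ) < n := by exact_mod_cast hn
    rw [div_le_iff₀ this, mul_comm]
    exact entropy_bound ν hf.measurable ha n
  · filter_upwards [eventually_gt_atTop 0] with n hn
    have : (0:ℝ) < n := by exact_mod_cast hn
    rw [le_div_iff₀ this, mul_comm]
    exact hsum n

end words

section final

variable {ι : Type*} [Fintype ι] [DecidableEq ι]

lemma birk_back (f : Equiv.Perm T) (φ : T → ℝ) (n : ℕ) (t : T) :
    birkhoffSum f φ n (f.symm^[n] t) = birkhoffSum f.symm φ n (f.symm t) := by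
  induction n with
  | zero => simp
  | succ n ih =>
    rw [birkhoffSum_succ', birkhoffSum_succ]
    have h1 : f (f.symm^[n+1] t) = f.symm^[n] t := by
      rw [Function.iterate_succ_apply']; simp
    rw [h1, ih, add_comm, Function.iterate_succ_apply]

lemma birk_upper' {ν : Measure T} [IsProbabilityMeasure ν] {g : T → T} (hg : Ergodic g ν)
    {φ : T → ℝ} (hm : Measurable φ) (hi : Integrable φ ν) {c : ℝ} (hneg : ∫ x, φ x ∂ν < c) :
    ∀ᵐ x ∂ν, ∃ B : ℝ, ∀ n : ℕ, birkhoffSum g φ n x ≤ n * c + B := by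
  have h1 : ∫ x, (φ x - c) ∂ν < 0 := by
    rw [integral_sub hi (integrable_const _)]; simp; linarith
  have h2 := birk_upper hg (hm.sub_const c) (hi.sub (integrable_const c)) h1
  filter_upwards [h2] with x hx
  obtain ⟨B, hB⟩ := hx
  refine ⟨B, fun n => ?_⟩
  have := hB n
  simp only [birkhoffSum, Finset.sum_sub_distrib, Finset.sum_const, Finset.card_range,
    nsmul_eq_mul] at this ⊢
  linarith

lemma two_sided (f : Equiv.Perm T) (hf : Continuous f) (hf' : Continuous f.symm)
    (ν : Measure T) [IsProbabilityMeasure ν] (herg : Ergodic (⇑f) ν) {a : T → ι}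
    (ha : ∀ b, MeasurableSet {x | a x = b}) (c : ℝ)
    (hc : liminf (fun n : ℕ => 
      (∫ x, -Real.log (ν.real (cyl f a (word f a n x))) ∂ν) / n) atTop < c) :
    ∀ᵐ t ∂ν, ∃ B : ℝ, ∀ᶠ n : ℕ in atTop, 
      0 < ν.real (cyl f a (word f a (2*n+1) (f.symm^[n] t))) ∧
      -Real.log (ν.real (cyl f a (word f a (2*n+1) (f.symm^[n] t)))) ≤ 
        (2*n+1) * c + B + 2 * Real.log (n+1) := by
  have hmp : MeasurePreserving f ν ν := herg.toMeasurePreserving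
  let e : T ≃ᵐ T := ⟨f, hf.measurable, hf'.measurable⟩
  have hergs : Ergodic (⇑f.symm) ν := Ergodic.symm (e := e) herg
  have hmps : MeasurePreserving f.symm ν ν := hergs.toMeasurePreserving
  obtain ⟨k, hk⟩ := exists_k ν hmp ha c hc
  obtain ⟨K, hK⟩ := log_Qm ν hmp ha k
  have pm : Measurable (phi f a ν k) := 
    ((word_fun_meas hf.measurable ha k (fun w => Real.log (ν.real (cyl f a w)))).comp 
      hf.measurable).sub 
      (word_fun_meas hf.measurable ha (k+1) (fun w => Real.log (ν.real (cyl f a w))))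
  have pI : Integrable (phi f a ν k) ν := 
    (hmp.integrable_comp_of_integrable 
      (word_fun_int ν hf.measurable ha k (fun w => Real.log (ν.real (cyl f a w))))).sub 
      (word_fun_int ν hf.measurable ha (k+1) (fun w => Real.log (ν.real (cyl f a w))))
  have b1 := birk_upper' herg pm pI hk
  have b2 := hmps.quasiMeasurePreserving.ae (birk_upper' hergs pm pI hk)
  have good : ∀ᵐ t ∂ν, ∀ n : ℕ, ∀ j, 0 < ν.real (cyl f a (word f a j (f.symm^[n] t))) := by
    rw [ae_all_iff]
    intro n
    exact (hmps.iterate n).quasiMeasurePreserving.ae (ae_good ν (f := f) (a := a))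
  let A : ℕ → Set T := fun n => f.symm^[n] ⁻¹' {x | ν.real (cyl f a (word f a (2*n+1) x)) ≤ 
    Qm f a ν k (word f a (2*n+1) x) * (1 / ((n:ℝ)+1)^2)}
  have hA : ∀ n, ν (A n) ≤ ENNReal.ofReal (1 / ((n:ℝ)+1)^2) := by
    intro n
    have hms : MeasurableSet {x | ν.real (cyl f a (word f a (2*n+1) x)) ≤ 
        Qm f a ν k (word f a (2*n+1) x) * (1 / ((n:ℝ)+1)^2)} := 
      measurableSet_le (word_fun_meas hf.measurable ha (2*n+1) (fun w => ν.real (cyl f a w)))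
        ((word_fun_meas hf.measurable ha (2*n+1) (fun w => Qm f a ν k w)).mul_const _)
    rw [(hmps.iterate n).measure_preimage hms.nullMeasurableSet]
    exact markov_bound ν hmp ha k (2*n+1) _ (by positivity)
  have hAs : ∑' n, ν (A n) ≠ ⊤ := by
    have hs : Summable (fun n : ℕ => 1 / ((n:ℝ)+1)^2) := by
      have := (summable_nat_add_iff 1).2 (Real.summable_one_div_nat_pow.2 one_lt_two)
      simpa using this
    exact ne_top_of_le_ne_top hs.tsum_ofReal_ne_top (ENNReal.tsum_le_tsum hA)
  filter_upwards [b1, b2, good, ae_eventually_notMem hAs] with t h1 h2 h3 h4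
  obtain ⟨B1, h1⟩ := h1
  obtain ⟨B2, h2⟩ := h2
  refine ⟨B1 + B2 + K, ?_⟩
  filter_upwards [h4] with n hn
  refine ⟨h3 n _, ?_⟩
  obtain ⟨q0, q1⟩ := hK _ (h3 n) (2*n+1)
  have hn' : Qm f a ν k (word f a (2*n+1) (f.symm^[n] t)) * (1 / ((n:ℝ)+1)^2) < 
      ν.real (cyl f a (word f a (2*n+1) (f.symm^[n] t))) := not_le.1 hn
  have hl := Real.log_le_log (by positivity) hn'.le
  rw [Real.log_mul q0.ne' (by positivity), one_div, Real.log_inv, Real.log_pow] at hl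
  have hs : birkhoffSum f (phi f a ν k) (2*n+1) (f.symm^[n] t) = 
      birkhoffSum f.symm (phi f a ν k) n (f.symm t) + birkhoffSum f (phi f a ν k) (n+1) t := by
    rw [show 2*n+1 = n + (n+1) by ring, birkhoffSum_add, birk_back]
    congr 2
    exact (Function.LeftInverse.iterate f.apply_symm_apply n) t
  have g1 := h1 (n+1)
  have g2 := h2 n
  push_cast at g1 hl
  rw [hs] at q1
  linarith

lemma cell_eq (f : Equiv.Perm T) (a : T → ι) (P : FinMeasPartition T)
    (haP : ∀ x y, y ∈ P.part x ↔ a y = a x) (n : ℕ) (x : T) :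
    oneSidedCell f P n x = cyl f a (word f a n x) := by
  induction n generalizing x with
  | zero => ext y; simp [oneSidedCell, word, cyl]
  | succ n ih =>
    ext y
    have : f y ∈ oneSidedCell f P n (f x) ↔ f y ∈ cyl f a (word f a n (f x)) := by rw [ih]
    simp only [word, cyl, Set.mem_ofPred_eq]
    rw [← this, ← haP]
    simp only [oneSidedCell, Set.mem_ofPred_eq]
    constructor
    · intro h
      refine ⟨by simpa using h 0 (by omega), fun i hi => ?_⟩
      have := h (i+1) (by omega)
      simpa [pow_succ] using this
    · rintro ⟨h0, h⟩ i hi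
      cases i with
      | zero => simpa using h0
      | succ i => 
        have := h i (by omega)
        simpa [pow_succ] using this

lemma exists_partition (ε : ℝ) (hε : 0 < ε) : ∃ P : FinMeasPartition T, 
    ∀ x y, y ∈ P.part x → dist x y < ε := by
  obtain ⟨s, -, hs, hcov⟩ := finite_cover_balls_of_compact (isCompact_univ (X := T)) (half_pos hε)
  let G : Set T → Set T := fun u => {y | ∀ c ∈ s, (dist y c < ε/2 ↔ c ∈ u)}
  let u : T → Set T := fun x => {c | c ∈ s ∧ dist x c < ε/2}
  have hmem : ∀ x y, y ∈ G (u x) ↔ ∀ c ∈ s, (dist y c < ε/2 ↔ dist x c < ε/2) := by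
    intro x y
    simp only [G, u, Set.mem_ofPred_eq]
    exact forall₂_congr fun c hc => by simp [hc]
  refine ⟨⟨fun x => G (u x), ?_, ?_, ?_, ?_⟩, ?_⟩
  · intro x; rw [hmem]; exact fun c _ => Iff.rfl
  · intro x
    have : G (u x) = ⋂ c ∈ s, {y | dist y c < ε/2 ↔ c ∈ u x} := by
      ext y; simp [G]
    rw [this]
    refine hs.measurableSet_biInter fun c _ => ?_
    have hb : MeasurableSet {y | dist y c < ε/2} := 
      measurableSet_lt (measurable_id.dist measurable_const) measurable_const
    by_cases h : c ∈ u x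
    · simpa [h] using hb
    · have e : {y | dist y c < ε/2 ↔ c ∈ u x} = {y | dist y c < ε/2}ᶜ := by
        ext y; simp [h]
      rw [e]; exact hb.compl
  · intro x y hy
    ext z
    rw [hmem] at hy
    simp only [hmem]
    exact forall₂_congr fun c hc => by rw [hy c hc]
  · refine (hs.finite_subsets.image G).subset ?_
    rintro _ ⟨x, rfl⟩
    exact ⟨u x, fun c hc => hc.1, rfl⟩
  · intro x y hy
    have hx := hcov (Set.mem_univ x)
    simp only [Set.mem_iUnion] at hx
    obtain ⟨c, hc, hxc⟩ := hx
    have h1 : dist x c < ε/2 := hxc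
    have h2 := ((hmem x y).1 hy c hc).2 h1
    have := dist_triangle_right x y c
    linarith

lemma main_eps (f : Equiv.Perm T) (hf : Continuous f) (hf' : Continuous f.symm)
    (ν : Measure T) [IsProbabilityMeasure ν] (herg : Ergodic (⇑f) ν)
    (hfin : ksEntropy f ν ≠ ⊤) (ε : ℝ) (hε : 0 < ε) (c : ℝ) (hc : (ksEntropy f ν).toReal < c) :
    ∀ᵐ t ∂ν, (∀ᶠ n : ℕ in atTop, 0 < (ν (twoSidedBall f n t ε)).toReal) ∧ limsup
          (fun n : ℕ => ((-Real.log (ν (twoSidedBall f n t ε)).toReal / n : ℝ) : EReal))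
          atTop ≤ ((2 * c : ℝ) : EReal) := by
  classical
  obtain ⟨P, hP⟩ := exists_partition (T := T) ε hε
  have : Fintype (Set.range P.part) := P.finite_range.fintype
  let a : T → Set.range P.part := fun x => ⟨P.part x, x, rfl⟩
  have haP : ∀ x y, y ∈ P.part x ↔ a y = a x := by
    intro x y
    constructor
    · intro h; exact Subtype.ext (P.part_eq x y h)
    · intro h
      have h' : P.part y = P.part x := congrArg Subtype.val h
      rw [← h']; exact P.mem_part y
  have ha : ∀ b, MeasurableSet {x | a x = b} := by
    rintro ⟨_, z, rfl⟩
    have : {x | a x = ⟨P.part z, z, rfl⟩} = P.part z := by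
      ext x; exact (haP z x).symm
    rw [this]; exact P.measSet z
  have hh : partitionEntropy f ν P < c := by
    refine lt_of_le_of_lt ?_ hc
    have h1 : ENNReal.ofReal (partitionEntropy f ν P) ≤ ksEntropy f ν := 
      le_iSup (fun P : FinMeasPartition T => ENNReal.ofReal (partitionEntropy f ν P)) P
    have h2 := ENNReal.toReal_mono hfin h1
    exact (by rw [ENNReal.toReal_ofReal']; exact le_max_left _ _ : partitionEntropy f ν P ≤ _).trans h2
  have hl : liminf (fun n : ℕ => 
      (∫ x, -Real.log (ν.real (cyl f a (word f a n x))) ∂ν) / n) atTop < c := by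
    convert hh using 1
    simp only [partitionEntropy, cell_eq f a P haP]
    rfl
  have hmps : MeasurePreserving f.symm ν ν := 
    MeasurePreserving.symm (⟨f, hf.measurable, hf'.measurable⟩ : T ≃ᵐ T) herg.toMeasurePreserving
  filter_upwards [two_sided f hf hf' ν herg ha c hl] with t ht
  obtain ⟨B, hB⟩ := ht
  have hball : ∀ n : ℕ, ν.real (cyl f a (word f a (2*n+1) (f.symm^[n] t))) ≤ 
      (ν (twoSidedBall f n t ε)).toReal := by
    intro n
    rw [← (hmps.iterate n).measureReal_preimage 
      (meas_cyl hf.measurable ha _).nullMeasurableSet, ← cell_eq f a P haP]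
    refine measureReal_mono ?_ (measure_ne_top _ _)
    intro y hy i hi
    have hy' : ∀ j : ℕ, j < 2*n+1 → (f^j) (f.symm^[n] y) ∈ P.part ((f^j) (f.symm^[n] t)) := hy
    have hi' := abs_le.1 hi
    have key : ∀ z, (f ^ (i+n).toNat) (f.symm^[n] z) = (f^i) z := by
      intro z
      have e1 : f.symm^[n] z = (f^(-(n:ℤ))) z := by
        rw [zpow_neg, zpow_natCast, ← inv_pow, Equiv.Perm.iterate_eq_pow]; rfl
      rw [e1, ← zpow_natCast, Int.toNat_of_nonneg (by omega), ← Equiv.Perm.mul_apply, ← zpow_add]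
      congr 2; ring
    have := hy' (i+n).toNat (by omega)
    rw [key, key] at this
    exact hP _ _ this
  refine ⟨hB.mono fun n hn => hn.1.trans_le (hball n), ?_⟩
  have hlim : Tendsto (fun n : ℕ => 2 * c + (c + B) / n + 2 * (Real.log (n+1) / n)) atTop 
      (nhds (2*c)) := by
    have t1 : Tendsto (fun n : ℕ => (c + B) / (n:ℝ)) atTop (nhds 0) := 
      tendsto_const_div_atTop_nhds_zero_nat _
    have t2 : Tendsto (fun n : ℕ => Real.log ((n:ℝ)+1) / n) atTop (nhds 0) := by
      have := (Real.isLittleO_log_id_atTop.tendsto_div_nhds_zero).comp 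
        (tendsto_atTop_add_const_right atTop (1:ℝ) (tendsto_natCast_atTop_atTop (R := ℝ)))
      have t3 : Tendsto (fun n : ℕ => 1 + (1:ℝ) / (n:ℝ)) atTop (nhds (1+0)) := 
        tendsto_const_nhds.add (tendsto_const_div_atTop_nhds_zero_nat _)
      have t4 := this.mul t3
      rw [zero_mul] at t4
      refine t4.congr' ?_
      filter_upwards [eventually_gt_atTop 0] with n hn
      have : (0:ℝ) < n := by exact_mod_cast hn
      simp only [Function.comp, id]
      field_simp
    have := (tendsto_const_nhds (x := 2*c)).add t1 |>.add (t2.const_mul 2)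
    simpa using this
  have hlimE := (continuous_coe_real_ereal.tendsto (2*c)).comp hlim
  rw [← hlimE.limsup_eq]
  refine limsup_le_limsup ?_
  filter_upwards [hB, eventually_gt_atTop 0] with n hn hn0
  simp only [Function.comp]
  rw [EReal.coe_le_coe_iff]
  have n0 : (0:ℝ) < n := by exact_mod_cast hn0
  rw [div_le_iff₀ n0]
  have := Real.log_le_log hn.1 (hball n)
  have e : (2 * c + (c + B) / n + 2 * (Real.log (n+1) / n)) * n = 
      (2*n+1) * c + B + 2 * Real.log (n+1) := by field_simp; ring
  rw [e]
  linarith [hn.2]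

lemma ball_mono (f : Equiv.Perm T) (ν : Measure T) [IsProbabilityMeasure ν] (n : ℕ) (t : T)
    (ε ε' : ℝ) (h : ε ≤ ε') : 
    (ν (twoSidedBall f n t ε)).toReal ≤ (ν (twoSidedBall f n t ε')).toReal := 
  measureReal_mono (fun _ hs i hi => (hs i hi).trans_le h) (measure_ne_top _ _)

end final

/-- upper bound in the two-sided Brin–Katok theorem: for ν-a.e. `t`,
`sup_{ε>0} limsup_n −(1/n) log ν(B_n^{f,±}(t,ε)) ≤ 2·h_ν(f)`. -/
theorem stmt12 (f : Equiv.Perm T) (hf : Continuous f) (hf' : Continuous f.symm)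
    (ν : Measure T) [IsProbabilityMeasure ν] (herg : Ergodic (⇑f) ν)
    (hfin : ksEntropy f ν ≠ ⊤) :
    ∀ᵐ t ∂ν,
      (⨆ ε : {e : ℝ // 0 < e}, Filter.limsup
          (fun n : ℕ => ((-Real.log (ν (twoSidedBall f n t ε)).toReal / n : ℝ) : EReal))
          Filter.atTop) ≤ ((2 * (ksEntropy f ν).toReal : ℝ) : EReal) := by
  have key : ∀ᵐ t ∂ν, ∀ m j : ℕ,
      (∀ᶠ n : ℕ in atTop, 0 < (ν (twoSidedBall f n t (1/((m:ℝ)+1)))).toReal) ∧ limsup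
          (fun n : ℕ => ((-Real.log (ν (twoSidedBall f n t (1/((m:ℝ)+1)))).toReal / n : ℝ) : EReal))
          atTop ≤ ((2 * ((ksEntropy f ν).toReal + 1/((j:ℝ)+1)) : ℝ) : EReal) := by
    rw [ae_all_iff]; intro m
    rw [ae_all_iff]; intro j
    exact main_eps f hf hf' ν herg hfin _ (by positivity) _
      (lt_add_of_pos_right _ (by positivity))
  filter_upwards [key] with t ht
  refine iSup_le fun ε => ?_
  obtain ⟨m, hm⟩ := exists_nat_one_div_lt ε.2
  have hlim : Tendsto (fun j : ℕ => ((2 * ((ksEntropy f ν).toReal + 1/((j:ℝ)+1)) : ℝ) : EReal))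
      atTop (nhds ((2 * (ksEntropy f ν).toReal : ℝ) : EReal)) := by
    refine (continuous_coe_real_ereal.tendsto _).comp ?_
    have := ((tendsto_const_nhds (x := (ksEntropy f ν).toReal)).add
      tendsto_one_div_add_atTop_nhds_zero_nat).const_mul 2
    simpa using this
  refine ge_of_tendsto' hlim fun j => le_trans ?_ (ht m j).2
  refine limsup_le_limsup ?_
  filter_upwards [(ht m j).1] with n hn
  rw [EReal.coe_le_coe_iff]
  have := Real.log_le_log hn (ball_mono f ν n t _ _ hm.le)
  gcongr
end
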